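/- arXiv:2107.10943 — 3 statements merged into one kernel-verified Lean document; each statement's English description precedes it below -/
import Mathlib

section
/- Let ρ : ℝ × ℝ³ → ℝ and J, E, B : ℝ × ℝ³ → ℝ³ be smooth with: (ρ, J, E, B) satisfying Maxwell's equations, B = 0 identically, □²E = 0, □²ρ = 0, □²J = 0 and curl J = 0 everywhere. Let v ∈ ℝ³ with |v| < c, and assume in addition that E is bounded with E(t, x) → 0 as |(t, x)| → ∞ in ℝ⁴, and that the transformed field E''_v, defined by E''_v(Λ_v(t, x)) = E_∥(t, x) + γ_v E_⊥(t, x) (where E_∥ = ((E·v)/|v|²)v and E_⊥ = E − E_∥ for v ≠ 0, and E''_0 = E), is Schwartz in the spatial variable locally uniformly in time. Then there exist smooth E', B' : ℝ × ℝ³ → ℝ³ such that (ρ'_v, J'_v, E', B') satisfies Maxwell's equations, B' = 0 identically, and □²E' = 0; moreover □²ρ'_v = 0, □²J'_v = 0 and curl J'_v = 0 everywhere. -/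
noncomputable section

open Real MeasureTheory Filter

/-- Physical space `ℝ³`. -/
abbrev V3 : Type := Fin 3 → ℝ

/-- Partial derivative with respect to the time variable. -/
def ptd {E : Type} [NormedAddCommGroup E] [NormedSpace ℝ E]
    (f : ℝ × V3 → E) : ℝ × V3 → E :=
  fun p => deriv (fun s => f (s, p.2)) p.1

/-- Partial derivative in the `i`-th spatial direction. -/
def pxd {E : Type} [NormedAddCommGroup E] [NormedSpace ℝ E]
    (i : Fin 3) (f : ℝ × V3 → E) : ℝ × V3 → E :=
  fun p => fderiv ℝ (fun y => f (p.1, y)) p.2 (Pi.single i (1 : ℝ))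

/-- Spatial Laplacian. -/
def lap {E : Type} [NormedAddCommGroup E] [NormedSpace ℝ E]
    (f : ℝ × V3 → E) : ℝ × V3 → E :=
  fun p => ∑ i : Fin 3, pxd i (pxd i f) p

/-- Spatial divergence of a vector field. -/
def divg (F : ℝ × V3 → V3) : ℝ × V3 → ℝ :=
  fun p => ∑ i : Fin 3, pxd i (fun q => F q i) p

/-- Spatial curl of a vector field. -/
def curl (F : ℝ × V3 → V3) : ℝ × V3 → V3 :=
  fun p => ![pxd 1 (fun q => F q 2) p - pxd 2 (fun q => F q 1) p,
             pxd 2 (fun q => F q 0) p - pxd 0 (fun q => F q 2) p,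
             pxd 0 (fun q => F q 1) p - pxd 1 (fun q => F q 0) p]

/-- Spatial gradient of a scalar field. -/
def grad (f : ℝ × V3 → ℝ) : ℝ × V3 → V3 :=
  fun p i => pxd i f p

/-- The d'Alembertian `□² = Δ - μ₀ε₀ ∂²/∂t²`. -/
def box (μ₀ ε₀ : ℝ) {E : Type} [NormedAddCommGroup E] [NormedSpace ℝ E]
    (f : ℝ × V3 → E) : ℝ × V3 → E :=
  fun p => lap f p - (μ₀ * ε₀) • ptd (ptd f) p

/-- Maxwell's equations for charge `ρ`, current `J` and fields `E`, `B`. -/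
def Maxwell (ε₀ μ₀ : ℝ) (ρ : ℝ × V3 → ℝ) (J E B : ℝ × V3 → V3) : Prop :=
  ∀ p : ℝ × V3,
    divg E p = ρ p / ε₀ ∧ divg B p = 0 ∧
    curl E p = -(ptd B p) ∧
    curl B p = μ₀ • J p + (μ₀ * ε₀) • ptd E p

/-- `f` is Schwartz in the spatial variable, locally uniformly in time. -/
def SchwartzLocUnif {E : Type} [NormedAddCommGroup E] [NormedSpace ℝ E]
    (f : ℝ × V3 → E) : Prop :=
  ∀ (α β : Fin 3 → ℕ) (j : ℕ) (R : ℝ), ∃ C : ℝ, ∀ p : ℝ × V3, |p.1| ≤ R →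
    |∏ i : Fin 3, p.2 i ^ α i| *
      ‖(ptd^[j] ((pxd 0)^[β 0] ((pxd 1)^[β 1] ((pxd 2)^[β 2] f)))) p‖ ≤ C

/-- Euclidean norm on `ℝ³`. -/
def norm3 (x : V3) : ℝ := Real.sqrt (∑ i : Fin 3, x i ^ 2)

/-- Dot product on `ℝ³`. -/
def dot3 (x y : V3) : ℝ := ∑ i : Fin 3, x i * y i

/-- Cross product on `ℝ³`. -/
def cross3 (a b : V3) : V3 :=
  ![a 1 * b 2 - a 2 * b 1, a 2 * b 0 - a 0 * b 2, a 0 * b 1 - a 1 * b 0]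

/-- The Lorentz factor `γ_v`. -/
def gam (c : ℝ) (v : V3) : ℝ := 1 / Real.sqrt (1 - norm3 v ^ 2 / c ^ 2)

/-- The Lorentz boost `Λ_v` with velocity `v`. -/
def boost (c : ℝ) (v : V3) (p : ℝ × V3) : ℝ × V3 :=
  (gam c v * (p.1 - dot3 v p.2 / c ^ 2),
   p.2 + ((gam c v - 1) * dot3 v p.2 / norm3 v ^ 2 - gam c v * p.1) • v)

/-- Transformed charge `ρ'_v`, i.e. the function with
`ρ'_v (Λ_v p) = γ_v (ρ p - v·J p / c²)`. -/
def rhoTr (c : ℝ) (v : V3) (ρ : ℝ × V3 → ℝ) (J : ℝ × V3 → V3) : ℝ × V3 → ℝ :=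
  fun p => gam c v * (ρ (boost c (-v) p) - dot3 v (J (boost c (-v) p)) / c ^ 2)

/-- Transformed current `J'_v`, i.e. the function with
`J'_v (Λ_v p) = J p + ((γ_v - 1)(v·J p)/|v|² - γ_v ρ p) v`. -/
def JTr (c : ℝ) (v : V3) (ρ : ℝ × V3 → ℝ) (J : ℝ × V3 → V3) : ℝ × V3 → V3 :=
  fun p => J (boost c (-v) p) +
    ((gam c v - 1) * dot3 v (J (boost c (-v) p)) / norm3 v ^ 2
      - gam c v * ρ (boost c (-v) p)) • v

/-- Transformed electric field `E''_v`, i.e. the function with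
`E''_v (Λ_v p) = E_∥ p + γ_v E_⊥ p`. -/
def ETr (c : ℝ) (v : V3) (E : ℝ × V3 → V3) : ℝ × V3 → V3 :=
  fun p =>
    (dot3 (E (boost c (-v) p)) v / norm3 v ^ 2) • v +
    gam c v • (E (boost c (-v) p) - (dot3 (E (boost c (-v) p)) v / norm3 v ^ 2) • v)

/-- Spatial gradient of a complex scalar field. -/
def gradC (f : ℝ × V3 → ℂ) : ℝ × V3 → Fin 3 → ℂ :=
  fun p i => pxd i f p

/-- Spatial divergence of a complex vector field. -/
def divgC (F : ℝ × V3 → Fin 3 → ℂ) : ℝ × V3 → ℂ :=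
  fun p => ∑ i : Fin 3, pxd i (fun q => F q i) p

open scoped FourierTransform SchwartzMap ContDiff

theorem fderiv_fourier_apply {F : Type*} [NormedAddCommGroup F] [InnerProductSpace ℝ F]
    [FiniteDimensional ℝ F] [MeasurableSpace F] [BorelSpace F] {g : F → ℂ}
    (hg : Integrable g) (hg' : Integrable (fun ξ => ‖ξ‖ * ‖g ξ‖)) (m x : F) :
    fderiv ℝ (𝓕 g) x m = 𝓕 (fun ξ => -(2 * π * Complex.I) * (inner ℝ ξ m : ℝ) * g ξ) x := by
  have hintegrable : Integrable (VectorFourier.fourierSMulRight (innerSL ℝ) g) := by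
    refine (hg'.const_mul (2 * π * ‖innerSL ℝ (E := F)‖)).mono'
      hg.aestronglyMeasurable.fourierSMulRight (ae_of_all _ fun ξ => ?_)
    exact (VectorFourier.norm_fourierSMulRight_le _ _ _).trans (le_of_eq (by ring))
  rw [Real.fderiv_fourier hg hg', Real.fourier_eq, Real.fourier_eq,
    ContinuousLinearMap.integral_apply ((Real.fourierIntegral_convergent_iff x).2 hintegrable)]
  congr 1
  ext ξ
  simp only [VectorFourier.fourierSMulRight_apply, Circle.smul_def, smul_apply,
    Complex.real_smul, smul_eq_mul]
  erw [innerSL_apply_apply]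
  ring

theorem integrable_pow_mul_div_norm_sq {F : Type*} [NormedAddCommGroup F] [InnerProductSpace ℝ F]
    [FiniteDimensional ℝ F] [MeasurableSpace F] [BorelSpace F] (hdim : 2 < Module.finrank ℝ F)
    (h : 𝓢(F, ℂ)) (n : ℕ) :
    Integrable (fun ξ : F => ‖ξ‖ ^ n * ‖h ξ / (‖ξ‖ : ℂ) ^ 2‖) := by
  have : Nontrivial F := Module.nontrivial_of_finrank_pos (R := ℝ) (by omega)
  have hmeas : AEStronglyMeasurable (fun ξ : F => ‖ξ‖ ^ n * ‖h ξ / (‖ξ‖ : ℂ) ^ 2‖) := by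
    have := h.continuous.measurable
    refine Measurable.aestronglyMeasurable ?_
    fun_prop
  obtain ⟨C, hC⟩ : ∃ C, ∀ ξ, ‖h ξ‖ ≤ C := by
    obtain ⟨C, hC⟩ := h.decay' 0 0
    exact ⟨C, fun ξ => by simpa using! hC ξ⟩
  rw [← integrableOn_univ, ← Set.union_compl_self (Metric.ball (0 : F) 1)]
  refine IntegrableOn.union ?_ ?_
  · have hb : IntegrableOn (fun ξ : F => C * (‖ξ‖ ^ 2)⁻¹) (Metric.ball (0 : F) 1) := by
      refine Integrable.const_mul ?_ C
      refine (integrableOn_fun_norm_addHaar volume (f := fun y : ℝ => (y ^ 2)⁻¹)).2 ?_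
      obtain ⟨k, hk⟩ := Nat.exists_eq_add_of_lt hdim
      refine IntegrableOn.congr_fun (f := fun y : ℝ => y ^ k) ?_ (fun y hy => ?_) measurableSet_Ioo
      · exact ((continuous_pow k).integrableOn_Icc (a := 0) (b := 1)).mono_set
          Set.Ioo_subset_Icc_self
      · have : y ≠ 0 := hy.1.ne'
        rw [hk, show 2 + k + 1 - 1 = k + 2 by omega]
        simp only [smul_eq_mul]
        field_simp
        ring
    refine hb.mono' hmeas.restrict ?_
    filter_upwards [ae_restrict_mem Metric.isOpen_ball.measurableSet] with ξ hξ
    rw [mem_ball_zero_iff] at hξ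
    have h1 : ‖ξ‖ ^ n ≤ 1 := pow_le_one₀ (norm_nonneg _) hξ.le
    have hC0 : 0 ≤ C := (norm_nonneg _).trans (hC 0)
    simp only [norm_mul, norm_div, norm_pow, norm_norm, Complex.norm_real]
    calc _ ≤ 1 * (C / ‖ξ‖ ^ 2) := by gcongr; exact hC ξ
      _ = _ := by ring
  · refine (h.integrable_pow_mul volume n).integrableOn.mono' hmeas.restrict ?_
    filter_upwards [ae_restrict_mem Metric.isOpen_ball.measurableSet.compl] with ξ hξ
    have hξ : 1 ≤ ‖ξ‖ := by simpa using hξ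
    simp only [norm_mul, norm_div, norm_pow, norm_norm, Complex.norm_real]
    gcongr
    exact div_le_self (norm_nonneg _) (one_le_pow₀ hξ)

/-- In dimension at least three, Poisson's equation with Schwartz data has a smooth solution. -/
theorem SchwartzMap.exists_laplacian_eq {ι : Type*} [Fintype ι]
    (hdim : 2 < Fintype.card ι) (f : 𝓢(EuclideanSpace ℝ ι, ℂ)) :
    ∃ u : EuclideanSpace ℝ ι → ℂ, ContDiff ℝ (⊤ : ℕ∞) u ∧
      ∀ x, ∑ i, fderiv ℝ (fun y => fderiv ℝ u y (EuclideanSpace.basisFun ι ℝ i)) x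
        (EuclideanSpace.basisFun ι ℝ i) = f x := by
  set F := EuclideanSpace ℝ ι
  set b := EuclideanSpace.basisFun ι ℝ
  set h : 𝓢(F, ℂ) := 𝓕⁻ f with hh
  set g : F → ℂ := fun ξ => h ξ / (‖ξ‖ : ℂ) ^ 2 with hg
  have hmg : AEStronglyMeasurable g := by
    have := h.continuous.measurable
    refine Measurable.aestronglyMeasurable ?_
    fun_prop
  have hgi : ∀ n : ℕ, Integrable (fun ξ : F => ‖ξ‖ ^ n * ‖g ξ‖) :=
    integrable_pow_mul_div_norm_sq (by simpa [F] using hdim) h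
  have hgi0 : Integrable g := by
    rw [← integrable_norm_iff hmg]; simpa using hgi 0
  have hgi1 : Integrable (fun ξ : F => ‖ξ‖ * ‖g ξ‖) := by simpa using hgi 1
  have hmi : ∀ i, AEStronglyMeasurable
      (fun ξ : F => -(2 * π * Complex.I) * (inner ℝ ξ (b i) : ℝ) * g ξ) := fun i =>
    (Continuous.aestronglyMeasurable (by fun_prop)).mul hmg
  have hle : ∀ i (ξ : F), ‖-(2 * π * Complex.I) * (inner ℝ ξ (b i) : ℝ) * g ξ‖
      ≤ 2 * π * (‖ξ‖ * ‖g ξ‖) := by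
    intro i ξ
    have h1 : |inner ℝ ξ (b i)| ≤ ‖ξ‖ := by
      simpa using abs_real_inner_le_norm ξ (b i)
    simp only [norm_mul, norm_neg, Complex.norm_I, Complex.norm_real, Complex.norm_ofNat,
      Real.norm_eq_abs, abs_of_pos Real.pi_pos]
    have := mul_le_mul_of_nonneg_right h1 (norm_nonneg (g ξ))
    nlinarith [Real.pi_pos]
  have hii : ∀ i, Integrable (fun ξ : F => -(2 * π * Complex.I) * (inner ℝ ξ (b i) : ℝ) * g ξ) :=
    fun i => (hgi1.const_mul (2 * π)).mono' (hmi i) (ae_of_all _ (hle i))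
  have hii1 : ∀ i, Integrable (fun ξ : F =>
      ‖ξ‖ * ‖-(2 * π * Complex.I) * (inner ℝ ξ (b i) : ℝ) * g ξ‖) := fun i => by
    refine ((hgi 2).const_mul (2 * π)).mono'
      (continuous_norm.aestronglyMeasurable.mul (hmi i).norm) (ae_of_all _ fun ξ => ?_)
    rw [norm_mul, norm_norm, norm_norm]
    calc _ ≤ ‖ξ‖ * (2 * π * (‖ξ‖ * ‖g ξ‖)) := by gcongr; exact hle i ξ
      _ = _ := by ring
  have hsmooth : ContDiff ℝ (⊤ : ℕ∞) (𝓕 g) := Real.contDiff_fourier fun n _ => hgi n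
  have hii2 : ∀ i, Integrable (fun ξ : F => -(2 * π * Complex.I) * (inner ℝ ξ (b i) : ℝ) *
      (-(2 * π * Complex.I) * (inner ℝ ξ (b i) : ℝ) * g ξ)) := fun i => by
    refine ((hii1 i).const_mul (2 * π)).mono'
      ((Continuous.aestronglyMeasurable (by fun_prop)).mul (hmi i)) (ae_of_all _ fun ξ => ?_)
    rw [norm_mul, ← mul_assoc]
    gcongr
    have h1 : |inner ℝ ξ (b i)| ≤ ‖ξ‖ := by
      simpa using abs_real_inner_le_norm ξ (b i)
    simp only [norm_mul, norm_neg, Complex.norm_I, Complex.norm_real, Complex.norm_ofNat,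
      Real.norm_eq_abs, abs_of_pos Real.pi_pos]
    nlinarith [Real.pi_pos]
  have hsum : ∀ x, ∑ i, fderiv ℝ (fun y => fderiv ℝ (𝓕 g) y (b i)) x (b i)
      = -(4 * π ^ 2) * f x := by
    intro x
    have h1 : ∀ i, fderiv ℝ (fun y => fderiv ℝ (𝓕 g) y (b i)) x (b i) =
        𝓕 (fun ξ : F => -(2 * π * Complex.I) * (inner ℝ ξ (b i) : ℝ) *
      (-(2 * π * Complex.I) * (inner ℝ ξ (b i) : ℝ) * g ξ)) x := by
      intro i
      rw [← fderiv_fourier_apply (hii i) (hii1 i)]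
      congr 2
      ext y
      exact fderiv_fourier_apply hgi0 hgi1 (b i) y
    have h2 : f x = 𝓕 (h : F → ℂ) x := by
      rw [← SchwartzMap.fourier_coe, hh, FourierTransform.fourier_fourierInv_eq]
    simp only [h1, h2, Real.fourier_eq]
    rw [← integral_finsetSum _ fun i _ => (Real.fourierIntegral_convergent_iff x).2 (hii2 i),
      ← integral_const_mul]
    refine integral_congr_ae ?_
    have : Nonempty ι := Fintype.card_pos_iff.1 (by omega)
    filter_upwards [compl_mem_ae_iff.2 (measure_singleton (0 : F))] with ξ hξ
    have hξ : (‖ξ‖ : ℂ) ≠ 0 := by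
      rw [Complex.ofReal_ne_zero, norm_ne_zero_iff]
      exact hξ
    have h3 : (∑ i, ((inner ℝ ξ (b i) : ℝ) : ℂ) ^ 2) = (‖ξ‖ : ℂ) ^ 2 := by
      have := b.sum_sq_norm_inner_left ξ
      simp only [Real.norm_eq_abs, sq_abs] at this
      exact_mod_cast this
    simp only [Circle.smul_def, smul_eq_mul, hg]
    have h4 : ∀ i, -(2 * π * Complex.I) * (inner ℝ ξ (b i) : ℝ) *
        (-(2 * π * Complex.I) * (inner ℝ ξ (b i) : ℝ) * (h ξ / (‖ξ‖ : ℂ) ^ 2)) =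
        -(4 * π ^ 2) * (h ξ / (‖ξ‖ : ℂ) ^ 2) * ((inner ℝ ξ (b i) : ℝ) : ℂ) ^ 2 := fun i => by
      linear_combination (4 * π ^ 2) * (h ξ / (‖ξ‖ : ℂ) ^ 2) *
        ((inner ℝ ξ (b i) : ℝ) : ℂ) ^ 2 * Complex.I_sq
    simp only [h4]
    rw [← Finset.mul_sum, ← Finset.mul_sum, h3]
    field_simp
  refine ⟨fun x => -(4 * π ^ 2 : ℂ)⁻¹ * 𝓕 g x, contDiff_const.mul hsmooth, fun x => ?_⟩
  have hd : ∀ i, Differentiable ℝ (fun y => fderiv ℝ (𝓕 g) y (b i)) := fun i =>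
    ((hsmooth.fderiv_right (m := (⊤ : ℕ∞)) (by simp)).clm_apply contDiff_const).differentiable
      (by simp)
  have h5 : ∀ i, (fun y => fderiv ℝ (fun x => -(4 * π ^ 2 : ℂ)⁻¹ * 𝓕 g x) y (b i)) =
      fun y => -(4 * π ^ 2 : ℂ)⁻¹ * fderiv ℝ (𝓕 g) y (b i) := fun i => by
    ext y
    rw [fderiv_const_mul (hsmooth.differentiable (by simp) y)]
    simp
  change ∑ i, fderiv ℝ (fun y => fderiv ℝ (fun x => -(4 * π ^ 2 : ℂ)⁻¹ * 𝓕 g x) y (b i)) x (b i) = _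
  simp only [h5]
  have h6 : ∀ i, fderiv ℝ (fun y => -(4 * π ^ 2 : ℂ)⁻¹ * fderiv ℝ (𝓕 g) y (b i)) x (b i) =
      -(4 * π ^ 2 : ℂ)⁻¹ * fderiv ℝ (fun y => fderiv ℝ (𝓕 g) y (b i)) x (b i) := fun i => by
    rw [fderiv_const_mul (hd i x)]
    simp
  simp only [h6]
  rw [← Finset.mul_sum, hsum]
  have : (π : ℂ) ≠ 0 := by exact_mod_cast Real.pi_ne_zero
  field_simp

/-- The smooth scalar fields on spacetime. -/
def smoothFields : Submodule ℝ (ℝ × V3 → ℝ) where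
  carrier := {f | ContDiff ℝ (⊤ : ℕ∞) f}
  add_mem' {f g} hf hg := show ContDiff ℝ (⊤ : ℕ∞) (f + g) from ContDiff.add hf hg
  zero_mem' := show ContDiff ℝ (⊤ : ℕ∞) (fun _ : ℝ × V3 => (0 : ℝ)) from contDiff_const
  smul_mem' a f hf := show ContDiff ℝ (⊤ : ℕ∞) (a • f) from ContDiff.const_smul a hf

namespace smoothFields

theorem contDiff_coe (f : smoothFields) : ContDiff ℝ (⊤ : ℕ∞) (f : ℝ × V3 → ℝ) := f.2

theorem differentiable_coe (f : smoothFields) : Differentiable ℝ (f : ℝ × V3 → ℝ) :=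
  (contDiff_coe f).differentiable (by simp)

/-- The directional derivative along a spacetime vector, as an operator on smooth fields. -/
def dir (w : ℝ × V3) : Module.End ℝ smoothFields where
  toFun f := ⟨fun p => fderiv ℝ (f : ℝ × V3 → ℝ) p w,
    show ContDiff ℝ (⊤ : ℕ∞) (fun p => fderiv ℝ (f : ℝ × V3 → ℝ) p w) from
    ((contDiff_coe f).fderiv_right (m := (⊤ : ℕ∞)) (by simp)).clm_apply contDiff_const⟩
  map_add' f g := by
    ext p
    change fderiv ℝ ((f : ℝ × V3 → ℝ) + (g : ℝ × V3 → ℝ)) p w = _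
    rw [fderiv_add (differentiable_coe f p) (differentiable_coe g p)]
    rfl
  map_smul' a f := by
    ext p
    change fderiv ℝ (a • (f : ℝ × V3 → ℝ)) p w = _
    rw [fderiv_const_smul (differentiable_coe f p)]
    rfl

theorem dir_add (w w' : ℝ × V3) : dir (w + w') = dir w + dir w' := by
  ext f p
  exact map_add (fderiv ℝ (f : ℝ × V3 → ℝ) p) w w'

theorem dir_smul (a : ℝ) (w : ℝ × V3) : dir (a • w) = a • dir w := by
  ext f p
  exact map_smul (fderiv ℝ (f : ℝ × V3 → ℝ) p) a w

theorem dir_comm (w w' : ℝ × V3) : Commute (dir w) (dir w') := by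
  ext f p
  have hd : DifferentiableAt ℝ (fderiv ℝ (f : ℝ × V3 → ℝ)) p :=
    ((contDiff_coe f).fderiv_right (m := (⊤ : ℕ∞)) (by simp)).differentiable (by simp) p
  have h : ∀ a b : ℝ × V3, fderiv ℝ (fun q => fderiv ℝ (f : ℝ × V3 → ℝ) q a) p b =
      fderiv ℝ (fderiv ℝ (f : ℝ × V3 → ℝ)) p b a := fun a b => by
    rw [fderiv_clm_apply hd (by fun_prop)]
    simp
  change fderiv ℝ (fun q => fderiv ℝ (f : ℝ × V3 → ℝ) q w') p w =
    fderiv ℝ (fun q => fderiv ℝ (f : ℝ × V3 → ℝ) q w) p w'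
  rw [h, h]
  have hsymm : IsSymmSndFDerivAt ℝ (f : ℝ × V3 → ℝ) p :=
    (contDiff_coe f).contDiffAt.isSymmSndFDerivAt (by
      rw [minSmoothness_of_isRCLikeNormedField]
      exact WithTop.coe_le_coe.2 le_top)
  exact hsymm.eq w w'

theorem dir_dir_comm (w w' : ℝ × V3) (f : smoothFields) :
    dir w (dir w' f) = dir w' (dir w f) :=
  LinearMap.congr_fun (dir_comm w w') f

/-- The unit time vector. -/
def timeVec : ℝ × V3 := (1, 0)

/-- The spatial coordinate vectors. -/
def spaceVec (i : Fin 3) : ℝ × V3 := (0, Pi.single i 1)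

theorem eq_timeVec_add_spaceVec (w : ℝ × V3) :
    w = w.1 • timeVec + ∑ i, w.2 i • spaceVec i := by
  ext k
  · simp [timeVec, spaceVec, Fin.sum_univ_three]
  · fin_cases k <;> simp [timeVec, spaceVec, Fin.sum_univ_three]

theorem dir_eq (w : ℝ × V3) :
    dir w = w.1 • dir timeVec + ∑ i, w.2 i • dir (spaceVec i) := by
  conv_lhs => rw [eq_timeVec_add_spaceVec w]
  simp only [dir_add, dir_smul, Fin.sum_univ_three]

theorem pxd_eq_fderiv {G : Type} [NormedAddCommGroup G] [NormedSpace ℝ G] {F : ℝ × V3 → G}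
    (hF : Differentiable ℝ F) (i : Fin 3) : pxd i F = fun p => fderiv ℝ F p (spaceVec i) := by
  ext p
  have h := HasFDerivAt.comp (g := F) p.2 (hF (p.1, p.2)).hasFDerivAt
    ((hasFDerivAt_const p.1 p.2).prodMk (hasFDerivAt_id p.2))
  change fderiv ℝ (F ∘ Prod.mk p.1) p.2 (Pi.single i 1) = _
  rw [h.fderiv]
  simp [spaceVec]

theorem ptd_eq_fderiv {G : Type} [NormedAddCommGroup G] [NormedSpace ℝ G] {F : ℝ × V3 → G}
    (hF : Differentiable ℝ F) : ptd F = fun p => fderiv ℝ F p timeVec := by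
  ext p
  have h := (hF p).hasFDerivAt.comp_hasDerivAt p.1
    ((hasDerivAt_id p.1).prodMk (hasDerivAt_const p.1 p.2))
  exact h.deriv

theorem pxd_coe (f : smoothFields) (i : Fin 3) :
    pxd i (f : ℝ × V3 → ℝ) = dir (spaceVec i) f := pxd_eq_fderiv (differentiable_coe f) i

theorem ptd_coe (f : smoothFields) : ptd (f : ℝ × V3 → ℝ) = dir timeVec f :=
  ptd_eq_fderiv (differentiable_coe f)

/-- The components of a smooth vector field. -/
def comp {F : ℝ × V3 → V3} (hF : ContDiff ℝ (⊤ : ℕ∞) F) (k : Fin 3) : smoothFields :=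
  ⟨fun p => F p k, contDiff_pi.1 hF k⟩

theorem contDiff_pxd {F : ℝ × V3 → V3} (hF : ContDiff ℝ (⊤ : ℕ∞) F) (i : Fin 3) :
    ContDiff ℝ (⊤ : ℕ∞) (pxd i F) := by
  rw [pxd_eq_fderiv (hF.differentiable (by simp))]
  exact (hF.fderiv_right (m := (⊤ : ℕ∞)) (by simp)).clm_apply contDiff_const

theorem contDiff_ptd {F : ℝ × V3 → V3} (hF : ContDiff ℝ (⊤ : ℕ∞) F) :
    ContDiff ℝ (⊤ : ℕ∞) (ptd F) := by
  rw [ptd_eq_fderiv (hF.differentiable (by simp))]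
  exact (hF.fderiv_right (m := (⊤ : ℕ∞)) (by simp)).clm_apply contDiff_const

theorem comp_pxd {F : ℝ × V3 → V3} (hF : ContDiff ℝ (⊤ : ℕ∞) F) (i k : Fin 3) :
    comp (contDiff_pxd hF i) k = dir (spaceVec i) (comp hF k) := by
  ext p
  have hd := hF.differentiable (by simp)
  change pxd i F p k = fderiv ℝ (fun q => F q k) p (spaceVec i)
  rw [pxd_eq_fderiv hd, fderiv_apply (hd p)]
  rfl

theorem comp_ptd {F : ℝ × V3 → V3} (hF : ContDiff ℝ (⊤ : ℕ∞) F) (k : Fin 3) :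
    comp (contDiff_ptd hF) k = dir timeVec (comp hF k) := by
  ext p
  have hd := hF.differentiable (by simp)
  change ptd F p k = fderiv ℝ (fun q => F q k) p timeVec
  rw [ptd_eq_fderiv hd, fderiv_apply (hd p)]
  rfl

theorem iterate_pxd {F : ℝ × V3 → V3} (hF : ContDiff ℝ (⊤ : ℕ∞) F) (i : Fin 3) (n : ℕ) :
    ∃ h : ContDiff ℝ (⊤ : ℕ∞) ((pxd i)^[n] F), ∀ k,
      comp h k = ((dir (spaceVec i)) ^ n) (comp hF k) := by
  induction n with
  | zero => exact ⟨hF, fun k => rfl⟩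
  | succ n ih =>
    obtain ⟨h, hk⟩ := ih
    simp only [Function.iterate_succ_apply']
    refine ⟨contDiff_pxd h i, fun k => ?_⟩
    rw [comp_pxd h, hk, pow_succ']
    rfl

theorem iterate_ptd {F : ℝ × V3 → V3} (hF : ContDiff ℝ (⊤ : ℕ∞) F) (n : ℕ) :
    ∃ h : ContDiff ℝ (⊤ : ℕ∞) (ptd^[n] F), ∀ k,
      comp h k = ((dir timeVec) ^ n) (comp hF k) := by
  induction n with
  | zero => exact ⟨hF, fun k => rfl⟩
  | succ n ih =>
    obtain ⟨h, hk⟩ := ih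
    simp only [Function.iterate_succ_apply']
    refine ⟨contDiff_ptd h, fun k => ?_⟩
    rw [comp_ptd h, hk, pow_succ']
    rfl

theorem ptd_apply {F : ℝ × V3 → V3} (hF : ContDiff ℝ (⊤ : ℕ∞) F) (p : ℝ × V3) (k : Fin 3) :
    ptd F p k = (dir timeVec (comp hF k) : ℝ × V3 → ℝ) p := by
  rw [← comp_ptd]; rfl

/-- The d'Alembertian with `μ₀ε₀ = κ`, as an operator on smooth fields. -/
def dalembertian (κ : ℝ) : Module.End ℝ smoothFields :=
  ∑ i, dir (spaceVec i) * dir (spaceVec i) - κ • (dir timeVec * dir timeVec)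

theorem dalembertian_apply (κ : ℝ) (f : smoothFields) :
    dalembertian κ f = ∑ i, dir (spaceVec i) (dir (spaceVec i) f)
      - κ • dir timeVec (dir timeVec f) := by
  simp [dalembertian, Fin.sum_univ_three]

theorem box_coe (μ₀ ε₀ : ℝ) (f : smoothFields) (p : ℝ × V3) :
    box μ₀ ε₀ (f : ℝ × V3 → ℝ) p = (dalembertian (μ₀ * ε₀) f : ℝ × V3 → ℝ) p := by
  simp [box, lap, pxd_coe, ptd_coe, dalembertian_apply, Fin.sum_univ_three]

theorem box_apply (μ₀ ε₀ : ℝ) {F : ℝ × V3 → V3} (hF : ContDiff ℝ (⊤ : ℕ∞) F) (p : ℝ × V3)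
    (k : Fin 3) : box μ₀ ε₀ F p k = (dalembertian (μ₀ * ε₀) (comp hF k) : ℝ × V3 → ℝ) p := by
  have h1 : ∀ i, pxd i (pxd i F) p k =
      (dir (spaceVec i) (dir (spaceVec i) (comp hF k)) : ℝ × V3 → ℝ) p := fun i => by
    rw [← comp_pxd hF, ← comp_pxd]; rfl
  have h2 : ptd (ptd F) p k = (dir timeVec (dir timeVec (comp hF k)) : ℝ × V3 → ℝ) p := by
    rw [← comp_ptd hF, ← comp_ptd]; rfl
  simp [box, lap, h1, h2, dalembertian_apply, Fin.sum_univ_three]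

theorem divg_apply {F : ℝ × V3 → V3} (hF : ContDiff ℝ (⊤ : ℕ∞) F) (p : ℝ × V3) :
    divg F p = (∑ i, dir (spaceVec i) (comp hF i) : smoothFields).1 p := by
  have h : ∀ i, pxd i (fun q => F q i) = dir (spaceVec i) (comp hF i) :=
    fun i => pxd_coe (comp hF i) i
  simp [divg, h, Fin.sum_univ_three]

theorem curl_eq_zero_iff {F : ℝ × V3 → V3} (hF : ContDiff ℝ (⊤ : ℕ∞) F) :
    (∀ p, curl F p = 0) ↔
      ∀ i k, dir (spaceVec i) (comp hF k) = dir (spaceVec k) (comp hF i) := by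
  have h : ∀ i k, pxd i (fun q => F q k) = dir (spaceVec i) (comp hF k) :=
    fun i k => pxd_coe (comp hF k) i
  simp only [curl, h]
  constructor
  · intro H
    have H0 : ∀ p, _ := fun p => sub_eq_zero.1 (congrFun (H p) 0)
    have H1 : ∀ p, _ := fun p => sub_eq_zero.1 (congrFun (H p) 1)
    have H2 : ∀ p, _ := fun p => sub_eq_zero.1 (congrFun (H p) 2)
    intro i k
    ext p
    fin_cases i <;> fin_cases k <;>
      first
      | rfl
      | exact H0 p
      | exact H1 p
      | exact H2 p
      | exact (H0 p).symm
      | exact (H1 p).symm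
      | exact (H2 p).symm
  · intro H p
    ext k
    fin_cases k
    · exact sub_eq_zero.2 (by rw [H 1 2])
    · exact sub_eq_zero.2 (by rw [H 2 0])
    · exact sub_eq_zero.2 (by rw [H 0 1])

end smoothFields

namespace smoothFields

theorem dir_spaceVec_eq_zero {f : smoothFields} {t : ℝ} (h : ∀ x, (f : ℝ × V3 → ℝ) (t, x) = 0)
    (i : Fin 3) (x : V3) : (dir (spaceVec i) f : ℝ × V3 → ℝ) (t, x) = 0 := by
  rw [← pxd_coe]
  simp [pxd, h]

theorem eq_zero_of_dir_timeVec_eq_zero {f : smoothFields} (h : dir timeVec f = 0)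
    (h0 : ∀ x, (f : ℝ × V3 → ℝ) (0, x) = 0) : f = 0 := by
  ext p
  have hd : Differentiable ℝ fun s : ℝ => (f : ℝ × V3 → ℝ) (s, p.2) :=
    (differentiable_coe f).comp (by fun_prop)
  have h1 := is_const_of_deriv_eq_zero hd (fun s => by
    change ptd (f : ℝ × V3 → ℝ) (s, p.2) = 0
    rw [ptd_coe, h]; rfl) p.1 0
  exact h1.trans (h0 p.2)

theorem contDiff_intervalIntegral {H : Type*} [NormedAddCommGroup H] [NormedSpace ℝ H]
    [FiniteDimensional ℝ H] (n : ℕ) : ∀ {F : H × ℝ → ℝ}, ContDiff ℝ (⊤ : ℕ∞) F →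
    ContDiff ℝ n (fun x => ∫ s in (0 : ℝ)..1, F (x, s)) := by
  induction n with
  | zero =>
    intro F hF
    rw [Nat.cast_zero, contDiff_zero]
    exact intervalIntegral.continuous_parametric_intervalIntegral_of_continuous'
      (f := fun x s => F (x, s)) hF.continuous 0 1
  | succ n ih =>
    intro F hF
    have hdF : ContDiff ℝ (⊤ : ℕ∞) (fderiv ℝ F) := hF.fderiv_right (by simp)
    have key : ∀ x, HasFDerivAt (fun x => ∫ s in (0 : ℝ)..1, F (x, s))
        (∫ s in (0 : ℝ)..1, (fderiv ℝ F (x, s)).comp (ContinuousLinearMap.inl ℝ H ℝ)) x := by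
      intro x
      have hcont : Continuous fun q : H × ℝ =>
          (fderiv ℝ F q).comp (ContinuousLinearMap.inl ℝ H ℝ) :=
        hdF.continuous.clm_comp continuous_const
      obtain ⟨C, hC⟩ := ((isCompact_closedBall x 1).prod (isCompact_Icc (a := (0 : ℝ)) (b := 1))
        ).exists_bound_of_continuousOn hcont.continuousOn
      refine intervalIntegral.hasFDerivAt_integral_of_dominated_of_fderiv_le
        (F' := fun x s => (fderiv ℝ F (x, s)).comp (ContinuousLinearMap.inl ℝ H ℝ))
        (bound := fun _ => C)
        (Metric.closedBall_mem_nhds x one_pos)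
        (Eventually.of_forall fun y => Continuous.aestronglyMeasurable ?_)
        (Continuous.intervalIntegrable ?_ _ _)
        (Continuous.aestronglyMeasurable ?_)
        (ae_of_all _ fun s hs y hy => hC (y, s) ⟨hy, ?_⟩)
        intervalIntegrable_const
        (ae_of_all _ fun s hs y hy => ?_)
      · exact hF.continuous.comp (by fun_prop)
      · exact hF.continuous.comp (by fun_prop)
      · exact hcont.comp (by fun_prop)
      · rw [Set.uIoc_of_le zero_le_one] at hs
        exact Set.Ioc_subset_Icc_self hs
      · exact HasFDerivAt.comp (g := F) y (hF.differentiable (by simp) (y, s)).hasFDerivAt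
          (hasFDerivAt_prodMk_left y s)
    rw [Nat.cast_succ, contDiff_succ_iff_fderiv_apply]
    refine ⟨fun x => (key x).differentiableAt, by simp, fun y => ?_⟩
    have hintegrable : ∀ x, IntervalIntegrable
        (fun s => (fderiv ℝ F (x, s)).comp (ContinuousLinearMap.inl ℝ H ℝ)) volume 0 1 := fun x =>
      ((hdF.continuous.comp (by fun_prop : Continuous fun s : ℝ => (x, s))).clm_comp
        continuous_const).intervalIntegrable _ _
    have hy : (fun x => fderiv ℝ (fun x => ∫ s in (0 : ℝ)..1, F (x, s)) x y) =
        fun x => ∫ s in (0 : ℝ)..1, fderiv ℝ F (x, s) (y, 0) := by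
      ext x
      rw [(key x).fderiv, ContinuousLinearMap.intervalIntegral_apply (hintegrable x)]
      rfl
    rw [hy]
    exact ih (hdF.clm_apply contDiff_const)

/-- Every smooth field has a smooth time primitive that vanishes at time zero. -/
theorem exists_dir_timeVec_eq (g : smoothFields) :
    ∃ f : smoothFields, dir timeVec f = g ∧ ∀ x, (f : ℝ × V3 → ℝ) (0, x) = 0 := by
  let G : ℝ × V3 → ℝ := g
  have hG : ContDiff ℝ (⊤ : ℕ∞) G := contDiff_coe g
  have hscale : ∀ p : ℝ × V3, ∫ s in (0 : ℝ)..p.1, G (s, p.2) =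
      ∫ s in (0 : ℝ)..1, p.1 * G (p.1 * s, p.2) := fun p => by
    rw [intervalIntegral.integral_const_mul]
    simpa using (intervalIntegral.mul_integral_comp_mul_left
      (a := 0) (b := 1) (f := fun s => G (s, p.2)) p.1).symm
  have hsm : ContDiff ℝ (⊤ : ℕ∞) (fun p : ℝ × V3 => ∫ s in (0 : ℝ)..p.1, G (s, p.2)) := by
    simp only [hscale]
    refine contDiff_infty.2 fun n => ?_
    refine contDiff_intervalIntegral n
      (F := fun q : (ℝ × V3) × ℝ => q.1.1 * G (q.1.1 * q.2, q.1.2)) ?_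
    exact (contDiff_fst.comp contDiff_fst).mul (hG.comp (by fun_prop))
  refine ⟨⟨_, hsm⟩, ?_, fun x => by simp⟩
  ext p
  rw [← ptd_coe]
  change deriv (fun t => ∫ s in (0 : ℝ)..t, G (s, p.2)) p.1 = _
  exact (hG.continuous.comp (by fun_prop : Continuous fun s : ℝ => (s, p.2))).deriv_integral _ 0 p.1

/-- A charge density and a current forming a closed and divergence-free one-form, where
`κ = μ₀ε₀`. -/
structure IsClosedCurrent (κ : ℝ) (ρ : smoothFields) (J : Fin 3 → smoothFields) : Prop where
  curl_eq : ∀ i k, dir (spaceVec i) (J k) = dir (spaceVec k) (J i)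
  grad_eq : ∀ i, dir (spaceVec i) ρ = -(κ • dir timeVec (J i))
  div_eq : ∑ i, dir (spaceVec i) (J i) = -dir timeVec ρ

namespace IsClosedCurrent

variable {κ : ℝ} {ρ : smoothFields} {J : Fin 3 → smoothFields}

theorem dalembertian_charge (h : IsClosedCurrent κ ρ J) : dalembertian κ ρ = 0 := by
  have h1 : ∑ i, dir (spaceVec i) (dir (spaceVec i) ρ) =
      -(κ • dir timeVec (∑ i, dir (spaceVec i) (J i))) := by
    simp only [h.grad_eq, map_neg, map_smul, map_sum, Finset.sum_neg_distrib, ← Finset.smul_sum,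
      dir_dir_comm _ timeVec]
  rw [dalembertian_apply, h1, h.div_eq]
  simp

theorem dalembertian_current (h : IsClosedCurrent κ ρ J) (k : Fin 3) :
    dalembertian κ (J k) = 0 := by
  have h1 : ∑ i, dir (spaceVec i) (dir (spaceVec i) (J k)) =
      dir (spaceVec k) (∑ i, dir (spaceVec i) (J i)) := by
    rw [map_sum]
    refine Finset.sum_congr rfl fun i _ => ?_
    rw [h.curl_eq i k, dir_dir_comm]
  rw [dalembertian_apply, h1, h.div_eq, map_neg, dir_dir_comm, h.grad_eq]
  simp

/-- A closed current is the source of a curl-free electric field as soon as the initial charge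
density has a Newtonian potential. -/
theorem exists_field (h : IsClosedCurrent κ ρ J) {ε₀ : ℝ} (hε : ε₀ ≠ 0) {u : smoothFields}
    (hu : dir timeVec u = 0)
    (hu0 : ∀ x, (∑ i, dir (spaceVec i) (dir (spaceVec i) u) : smoothFields).1 (0, x) =
      (ε₀⁻¹ • ρ : smoothFields).1 (0, x)) :
    ∃ E : Fin 3 → smoothFields, (∑ i, dir (spaceVec i) (E i) = ε₀⁻¹ • ρ) ∧
      (∀ i k, dir (spaceVec i) (E k) = dir (spaceVec k) (E i)) ∧
      (∀ k, J k = -(ε₀ • dir timeVec (E k))) ∧ ∀ k, dalembertian κ (E k) = 0 := by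
  choose I hI hI0 using fun k => exists_dir_timeVec_eq (J k)
  have htime : ∀ k, dir timeVec (dir (spaceVec k) u - ε₀⁻¹ • I k) = -(ε₀⁻¹ • J k) := fun k => by
    rw [map_sub, map_smul, dir_dir_comm, hu, hI]
    simp
  have hcurl : ∀ i k, dir (spaceVec i) (dir (spaceVec k) u - ε₀⁻¹ • I k) =
      dir (spaceVec k) (dir (spaceVec i) u - ε₀⁻¹ • I i) := fun i k => by
    refine sub_eq_zero.1 (eq_zero_of_dir_timeVec_eq_zero ?_ fun x => ?_)
    · rw [map_sub, dir_dir_comm timeVec, dir_dir_comm timeVec, htime, htime, map_neg, map_neg,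
        map_smul, map_smul, h.curl_eq i k, sub_self]
    · rw [map_sub, map_sub, map_smul, map_smul, dir_dir_comm (spaceVec i) (spaceVec k)]
      have h1 := dir_spaceVec_eq_zero (hI0 k) i x
      have h2 := dir_spaceVec_eq_zero (hI0 i) k x
      simp [h1, h2]
  have hdiv : ∑ i, dir (spaceVec i) (dir (spaceVec i) u - ε₀⁻¹ • I i) = ε₀⁻¹ • ρ := by
    refine sub_eq_zero.1 (eq_zero_of_dir_timeVec_eq_zero ?_ fun x => ?_)
    · rw [map_sub, map_sum, map_smul]
      simp only [dir_dir_comm timeVec (spaceVec _), htime, map_neg, map_smul,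
        Finset.sum_neg_distrib, ← Finset.smul_sum, h.div_eq]
      simp
    · have h1 : ∀ k, _ := fun k => dir_spaceVec_eq_zero (hI0 k) k x
      have h2 := hu0 x
      simp only [Fin.sum_univ_three, Submodule.coe_add, Pi.add_apply, map_sub, map_smul,
        Submodule.coe_sub, Pi.sub_apply, Submodule.coe_smul, Pi.smul_apply, h1, smul_zero] at h2 ⊢
      linarith
  refine ⟨fun k => dir (spaceVec k) u - ε₀⁻¹ • I k, hdiv, hcurl, fun k => ?_, fun k => ?_⟩
  · rw [htime, smul_neg, neg_neg, smul_smul, mul_inv_cancel₀ hε, one_smul]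
  · have h1 : ∑ i, dir (spaceVec i) (dir (spaceVec i) (dir (spaceVec k) u - ε₀⁻¹ • I k)) =
        dir (spaceVec k) (ε₀⁻¹ • ρ) := by
      rw [← hdiv, map_sum]
      refine Finset.sum_congr rfl fun i _ => ?_
      rw [hcurl i k, dir_dir_comm]
    rw [dalembertian_apply, h1, htime, map_smul, h.grad_eq, map_neg, map_smul, smul_neg, smul_neg,
      smul_comm κ, sub_self]

end IsClosedCurrent

end smoothFields

namespace smoothFields

/-- The iterated partial derivative entering the definition of `SchwartzLocUnif`. -/
def partialDeriv (β : Fin 3 → ℕ) (j : ℕ) : Module.End ℝ smoothFields :=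
  dir timeVec ^ j * (dir (spaceVec 0) ^ β 0 * (dir (spaceVec 1) ^ β 1 * dir (spaceVec 2) ^ β 2))

/-- The smooth scalar fields that are Schwartz in space, locally uniformly in time. -/
def schwartzFields : Submodule ℝ smoothFields where
  carrier := {f | ∀ (α β : Fin 3 → ℕ) (j : ℕ) (R : ℝ), ∃ C : ℝ, ∀ p : ℝ × V3, |p.1| ≤ R →
    |∏ i : Fin 3, p.2 i ^ α i| * |(partialDeriv β j f : ℝ × V3 → ℝ) p| ≤ C}
  add_mem' {f g} hf hg α β j R := by
    obtain ⟨C, hC⟩ := hf α β j R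
    obtain ⟨C', hC'⟩ := hg α β j R
    refine ⟨C + C', fun p hp => ?_⟩
    rw [map_add]
    refine (mul_le_mul_of_nonneg_left (abs_add_le _ _) (abs_nonneg _)).trans ?_
    rw [mul_add]
    exact add_le_add (hC p hp) (hC' p hp)
  zero_mem' α β j R := ⟨0, fun p _ => by simp⟩
  smul_mem' a f hf α β j R := by
    obtain ⟨C, hC⟩ := hf α β j R
    refine ⟨|a| * C, fun p hp => ?_⟩
    rw [map_smul, Submodule.coe_smul, Pi.smul_apply, smul_eq_mul, abs_mul, mul_left_comm]
    exact mul_le_mul_of_nonneg_left (hC p hp) (abs_nonneg _)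

theorem dir_timeVec_mem {f : smoothFields} (hf : f ∈ schwartzFields) :
    dir timeVec f ∈ schwartzFields := by
  intro α β j R
  have hc : Commute (dir (spaceVec 0) ^ β 0 * (dir (spaceVec 1) ^ β 1 * dir (spaceVec 2) ^ β 2))
      (dir timeVec) :=
    ((dir_comm _ _).pow_left _).mul_left
      (((dir_comm _ _).pow_left _).mul_left ((dir_comm _ _).pow_left _))
  have h : partialDeriv β j * dir timeVec = partialDeriv β (j + 1) := by
    rw [partialDeriv, partialDeriv, mul_assoc, hc.eq, ← mul_assoc, ← pow_succ]
  obtain ⟨C, hC⟩ := hf α β (j + 1) R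
  rw [← h] at hC
  exact ⟨C, hC⟩

theorem dir_spaceVec_mem {f : smoothFields} (hf : f ∈ schwartzFields) (i : Fin 3) :
    dir (spaceVec i) f ∈ schwartzFields := by
  intro α β j R
  have h0 : ∀ i k n, dir (spaceVec i) ^ n * dir (spaceVec k) =
      dir (spaceVec k) * dir (spaceVec i) ^ n :=
    fun i k n => ((dir_comm (spaceVec i) (spaceVec k)).pow_left n).eq
  obtain ⟨β', h⟩ : ∃ β', partialDeriv β j * dir (spaceVec i) = partialDeriv β' j := by
    fin_cases i
    · refine ⟨![β 0 + 1, β 1, β 2], ?_⟩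
      change partialDeriv β j * dir (spaceVec 0) = dir timeVec ^ j * (dir (spaceVec 0) ^ (β 0 + 1) *
        (dir (spaceVec 1) ^ β 1 * dir (spaceVec 2) ^ β 2))
      rw [partialDeriv, pow_succ, mul_assoc, mul_assoc, mul_assoc, h0 2 0,
        ← mul_assoc (dir (spaceVec 1) ^ β 1), h0 1 0]
      simp only [mul_assoc]
    · refine ⟨![β 0, β 1 + 1, β 2], ?_⟩
      change partialDeriv β j * dir (spaceVec 1) = dir timeVec ^ j * (dir (spaceVec 0) ^ β 0 *
        (dir (spaceVec 1) ^ (β 1 + 1) * dir (spaceVec 2) ^ β 2))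
      rw [partialDeriv, pow_succ, mul_assoc, mul_assoc, mul_assoc, h0 2 1]
      simp only [mul_assoc]
    · refine ⟨![β 0, β 1, β 2 + 1], ?_⟩
      change partialDeriv β j * dir (spaceVec 2) = dir timeVec ^ j * (dir (spaceVec 0) ^ β 0 *
        (dir (spaceVec 1) ^ β 1 * dir (spaceVec 2) ^ (β 2 + 1)))
      rw [partialDeriv, pow_succ]
      simp only [mul_assoc]
  obtain ⟨C, hC⟩ := hf α β' j R
  rw [← h] at hC
  exact ⟨C, hC⟩

theorem dir_mem {f : smoothFields} (hf : f ∈ schwartzFields) (w : ℝ × V3) :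
    dir w f ∈ schwartzFields := by
  rw [dir_eq w]
  simp only [LinearMap.add_apply, LinearMap.smul_apply, LinearMap.sum_apply]
  exact Submodule.add_mem _ (Submodule.smul_mem _ _ (dir_timeVec_mem hf))
    (Submodule.sum_mem _ fun i _ => Submodule.smul_mem _ _ (dir_spaceVec_mem hf i))

theorem comp_mem_schwartzFields {F : ℝ × V3 → V3} (hF : ContDiff ℝ (⊤ : ℕ∞) F)
    (hS : SchwartzLocUnif F) (k : Fin 3) : comp hF k ∈ schwartzFields := by
  intro α β j R
  obtain ⟨C, hC⟩ := hS α β j R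
  obtain ⟨h2, e2⟩ := iterate_pxd hF 2 (β 2)
  obtain ⟨h1, e1⟩ := iterate_pxd h2 1 (β 1)
  obtain ⟨h0, e0⟩ := iterate_pxd h1 0 (β 0)
  obtain ⟨ht, et⟩ := iterate_ptd h0 j
  have e : partialDeriv β j (comp hF k) = comp ht k := by
    rw [et, e0, e1, e2]
    rfl
  refine ⟨C, fun p hp => le_trans ?_ (hC p hp)⟩
  rw [e]
  exact mul_le_mul_of_nonneg_left (norm_le_pi_norm
    (ptd^[j] ((pxd 0)^[β 0] ((pxd 1)^[β 1] ((pxd 2)^[β 2] F))) p) k) (abs_nonneg _)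

theorem exists_norm_pow_mul_le {f : smoothFields} (hf : f ∈ schwartzFields) (t : ℝ) (k : ℕ) :
    ∃ C : ℝ, ∀ x : V3, ‖x‖ ^ k * |(f : ℝ × V3 → ℝ) (t, x)| ≤ C := by
  choose C hC using fun i : Fin 3 => hf (Pi.single i k) 0 0 |t|
  refine ⟨∑ i, C i, fun x => ?_⟩
  have hi : ∀ i, |x i| ^ k * |(f : ℝ × V3 → ℝ) (t, x)| ≤ C i := fun i => by
    have h1 : ∏ l : Fin 3, x l ^ (Pi.single i k : Fin 3 → ℕ) l = x i ^ k := by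
      rw [Finset.prod_eq_single i (fun l _ hl => by simp [Pi.single_eq_of_ne hl]) (by simp)]
      simp
    have h2 := hC i (t, x) le_rfl
    rw [h1, abs_pow] at h2
    exact h2
  obtain ⟨i, hmax⟩ : ∃ i, ‖x‖ = |x i| := by
    obtain ⟨i, -, h⟩ := Finset.exists_max_image Finset.univ (fun i => |x i|) Finset.univ_nonempty
    exact ⟨i, le_antisymm ((pi_norm_le_iff_of_nonneg (abs_nonneg _)).2 fun l =>
      h l (Finset.mem_univ l)) (norm_le_pi_norm x i)⟩
  rw [hmax]
  exact (hi i).trans (Finset.single_le_sum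
    (fun l _ => le_trans (by positivity) (hi l)) (Finset.mem_univ i))

theorem exists_norm_pow_mul_iteratedFDeriv_le (t : ℝ) (k n : ℕ) :
    ∀ f ∈ schwartzFields, ∃ C : ℝ, ∀ x : V3,
      ‖x‖ ^ k * ‖iteratedFDeriv ℝ n (fun y => (f : ℝ × V3 → ℝ) (t, y)) x‖ ≤ C := by
  induction n with
  | zero =>
    intro f hf
    simpa using exists_norm_pow_mul_le hf t k
  | succ n ih =>
    intro f hf
    choose C hC using fun i => ih _ (dir_spaceVec_mem hf i)
    have hsl : ∀ g : smoothFields, ContDiff ℝ (⊤ : ℕ∞) (fun y => (g : ℝ × V3 → ℝ) (t, y)) :=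
      fun g => (contDiff_coe g).comp (by fun_prop)
    let φ : Fin 3 → V3 →L[ℝ] ℝ := fun i => ContinuousLinearMap.proj i
    let T : Fin 3 → ℝ →L[ℝ] (V3 →L[ℝ] ℝ) := fun i =>
      ContinuousLinearMap.smulRight (1 : ℝ →L[ℝ] ℝ) (φ i)
    have hfd : fderiv ℝ (fun y => (f : ℝ × V3 → ℝ) (t, y)) =
        fun x => ∑ i, ((T i) ∘ (fun y => (dir (spaceVec i) f : ℝ × V3 → ℝ) (t, y))) x := by
      ext y w
      have hw : w = ∑ i, w i • (Pi.single i 1 : V3) := by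
        ext l
        fin_cases l <;> simp [Fin.sum_univ_three]
      have h1 : ∀ i, (dir (spaceVec i) f : ℝ × V3 → ℝ) (t, y) =
          fderiv ℝ (fun y => (f : ℝ × V3 → ℝ) (t, y)) y (Pi.single i 1) := fun i => by
        rw [← pxd_coe]; rfl
      conv_lhs => rw [hw]
      simp [Fin.sum_univ_three, h1, T, φ]
      ring
    refine ⟨∑ i, ‖T i‖ * C i, fun x => ?_⟩
    rw [← norm_iteratedFDeriv_fderiv, hfd]
    have hT : ∀ i, ContDiff ℝ (⊤ : ℕ∞)
        ((T i) ∘ (fun y => (dir (spaceVec i) f : ℝ × V3 → ℝ) (t, y))) :=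
      fun i => (T i).contDiff.comp (hsl _)
    have hsum := iteratedFDeriv_sum (𝕜 := ℝ) (i := n) (u := Finset.univ)
      (f := fun i => (T i) ∘ (fun y => (dir (spaceVec i) f : ℝ × V3 → ℝ) (t, y)))
      (fun i _ => ((hT i).of_le (by exact_mod_cast le_top)))
    rw [hsum]
    calc _ ≤ ‖x‖ ^ k * ∑ i, ‖T i‖ * ‖iteratedFDeriv ℝ n
          (fun y => (dir (spaceVec i) f : ℝ × V3 → ℝ) (t, y)) x‖ := by
          gcongr
          rw [Finset.sum_apply]
          refine (norm_sum_le _ _).trans (Finset.sum_le_sum fun i _ => ?_)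
          exact (T i).norm_iteratedFDeriv_comp_left ((hsl _).contDiffAt (x := x))
            (by exact_mod_cast le_top)
      _ ≤ _ := by
          rw [Finset.mul_sum]
          refine Finset.sum_le_sum fun i _ => ?_
          rw [mul_left_comm]
          exact mul_le_mul_of_nonneg_left (hC i x) (ContinuousLinearMap.opNorm_nonneg (T i))

/-- A time slice of a field that is Schwartz in space, as a complex Schwartz function. -/
def slice {f : smoothFields} (hf : f ∈ schwartzFields) (t : ℝ) :
    𝓢(EuclideanSpace ℝ (Fin 3), ℂ) :=
  SchwartzMap.postcompCLM Complex.ofRealCLM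
    (SchwartzMap.compCLMOfContinuousLinearEquiv ℝ (EuclideanSpace.equiv (Fin 3) ℝ)
      { toFun := fun y => (f : ℝ × V3 → ℝ) (t, y)
        smooth' := (contDiff_coe f).comp (by fun_prop)
        decay' := fun k n => exists_norm_pow_mul_iteratedFDeriv_le t k n f hf })

/-- The time-independent field given by the real part of a complex function on space. -/
def static {φ : EuclideanSpace ℝ (Fin 3) → ℂ} (hφ : ContDiff ℝ (⊤ : ℕ∞) φ) : smoothFields :=
  ⟨fun p => (φ (WithLp.toLp 2 p.2)).re,
    Complex.reCLM.contDiff.comp (hφ.comp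
      ((EuclideanSpace.equiv (Fin 3) ℝ).symm.contDiff.comp contDiff_snd))⟩

theorem dir_spaceVec_static {φ : EuclideanSpace ℝ (Fin 3) → ℂ} (hφ : ContDiff ℝ (⊤ : ℕ∞) φ)
    {i : Fin 3} (hφ' : ContDiff ℝ (⊤ : ℕ∞)
      fun x => fderiv ℝ φ x (EuclideanSpace.basisFun (Fin 3) ℝ i)) :
    dir (spaceVec i) (static hφ) = static hφ' := by
  ext p
  have h := Complex.reCLM.hasFDerivAt.comp p
    (HasFDerivAt.comp (g := φ) p (hφ.differentiable (by simp) (WithLp.toLp 2 p.2)).hasFDerivAt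
      (((EuclideanSpace.equiv (Fin 3) ℝ).symm.toContinuousLinearMap.comp
        (ContinuousLinearMap.snd ℝ ℝ V3)).hasFDerivAt))
  refine (congrArg (fun L => L (spaceVec i)) h.fderiv).trans ?_
  simp [spaceVec, static]

theorem dir_timeVec_static {φ : EuclideanSpace ℝ (Fin 3) → ℂ} (hφ : ContDiff ℝ (⊤ : ℕ∞) φ) :
    dir timeVec (static hφ) = 0 := by
  ext p
  rw [← ptd_coe]
  simp [ptd, static]

/-- Every time slice of a field that is Schwartz in space has a Newtonian potential. -/
theorem exists_potential {f : smoothFields} (hf : f ∈ schwartzFields) (t : ℝ) :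
    ∃ u : smoothFields, dir timeVec u = 0 ∧ ∀ x,
      (∑ i, dir (spaceVec i) (dir (spaceVec i) u) : smoothFields).1 (t, x) = f.1 (t, x) := by
  obtain ⟨φ, hφ, h⟩ := SchwartzMap.exists_laplacian_eq (by simp) (slice hf t)
  have h1 : ∀ i, ContDiff ℝ (⊤ : ℕ∞)
      fun x => fderiv ℝ φ x (EuclideanSpace.basisFun (Fin 3) ℝ i) := fun i =>
    (hφ.fderiv_right (m := (⊤ : ℕ∞)) (by simp)).clm_apply contDiff_const
  have h2 : ∀ i, ContDiff ℝ (⊤ : ℕ∞)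
      fun x => fderiv ℝ (fun y => fderiv ℝ φ y (EuclideanSpace.basisFun (Fin 3) ℝ i)) x
        (EuclideanSpace.basisFun (Fin 3) ℝ i) := fun i =>
    ((h1 i).fderiv_right (m := (⊤ : ℕ∞)) (by simp)).clm_apply contDiff_const
  refine ⟨static hφ, dir_timeVec_static hφ, fun x => ?_⟩
  simp only [dir_spaceVec_static hφ (h1 _), dir_spaceVec_static (h1 _) (h2 _)]
  have h3 := congrArg Complex.re (h (WithLp.toLp 2 x))
  rw [Complex.re_sum] at h3
  rw [Submodule.coe_sum, Finset.sum_apply]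
  exact h3

end smoothFields

namespace smoothFields

/-- The composition of a smooth field with a linear map of spacetime. -/
def precomp (A : ℝ × V3 →L[ℝ] ℝ × V3) : Module.End ℝ smoothFields where
  toFun f := ⟨fun p => (f : ℝ × V3 → ℝ) (A p), (contDiff_coe f).comp A.contDiff⟩
  map_add' _ _ := rfl
  map_smul' _ _ := rfl

theorem precomp_apply (A : ℝ × V3 →L[ℝ] ℝ × V3) (f : smoothFields) (p : ℝ × V3) :
    (precomp A f : ℝ × V3 → ℝ) p = (f : ℝ × V3 → ℝ) (A p) := rfl

theorem dir_precomp (A : ℝ × V3 →L[ℝ] ℝ × V3) (w : ℝ × V3) (f : smoothFields) :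
    dir w (precomp A f) = precomp A (dir (A w) f) := by
  ext p
  have h := HasFDerivAt.comp (g := (f : ℝ × V3 → ℝ)) p (differentiable_coe f (A p)).hasFDerivAt
    A.hasFDerivAt
  exact congrArg (fun L => L w) h.fderiv

end smoothFields

theorem norm3_sq (v : V3) : norm3 v ^ 2 = ∑ i, v i ^ 2 :=
  Real.sq_sqrt (Finset.sum_nonneg fun i _ => sq_nonneg (v i))

theorem norm3_neg (v : V3) : norm3 (-v) = norm3 v := by simp [norm3]

theorem gam_neg (c : ℝ) (v : V3) : gam c (-v) = gam c v := by simp [gam, norm3_neg]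

theorem eq_zero_of_norm3_eq_zero {v : V3} (h : norm3 v = 0) : v = 0 := by
  have h1 : ∑ i, v i ^ 2 = 0 := by rw [← norm3_sq, h]; simp
  ext i
  simpa using (Finset.sum_eq_zero_iff_of_nonneg fun i _ => sq_nonneg (v i)).1 h1 i
    (Finset.mem_univ i)

theorem gam_sq_mul {c : ℝ} {v : V3} (hv : norm3 v < c) :
    gam c v ^ 2 * (1 - norm3 v ^ 2 / c ^ 2) = 1 := by
  have h0 : 0 ≤ norm3 v := Real.sqrt_nonneg _
  have h : 0 < 1 - norm3 v ^ 2 / c ^ 2 := by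
    rw [sub_pos, div_lt_one (pow_pos (h0.trans_lt hv) 2)]
    exact pow_lt_pow_left₀ hv h0 two_ne_zero
  rw [gam, div_pow, Real.sq_sqrt h.le, one_pow, one_div_mul_cancel h.ne']

theorem gam_ne_zero {c : ℝ} {v : V3} (hv : norm3 v < c) : gam c v ≠ 0 := fun h => by
  simpa [h] using gam_sq_mul hv

/-- The coefficient `(γ_v - 1) / |v|²` of the Lorentz boost. -/
def boostCoeff (c : ℝ) (v : V3) : ℝ := (gam c v - 1) / norm3 v ^ 2

theorem boostCoeff_neg (c : ℝ) (v : V3) : boostCoeff c (-v) = boostCoeff c v := by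
  simp [boostCoeff, gam_neg, norm3_neg]

theorem boostCoeff_mul {c : ℝ} (v : V3) : boostCoeff c v * norm3 v ^ 2 = gam c v - 1 := by
  by_cases h : norm3 v = 0
  · simp [boostCoeff, h, gam]
  · exact div_mul_cancel₀ _ (pow_ne_zero 2 h)

theorem boostCoeff_mul_apply {c : ℝ} {v : V3} (hv : norm3 v < c) (k : Fin 3) :
    boostCoeff c v * (1 + gam c v) * v k = gam c v ^ 2 / c ^ 2 * v k := by
  by_cases h : norm3 v = 0
  · simp [eq_zero_of_norm3_eq_zero h]
  · have h1 := boostCoeff_mul (c := c) v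
    have h2 := gam_sq_mul hv
    congr 1
    refine mul_right_cancel₀ (pow_ne_zero 2 h) ?_
    linear_combination (1 + gam c v) * h1 + h2

theorem boost_eq (c : ℝ) (v : V3) (p : ℝ × V3) :
    boost c v p = (gam c v * (p.1 - dot3 v p.2 / c ^ 2),
      p.2 + (boostCoeff c v * dot3 v p.2 - gam c v * p.1) • v) := by
  rw [boost, boostCoeff, div_mul_eq_mul_div]

/-- The Lorentz boost as a continuous linear map. -/
def boostCLM (c : ℝ) (v : V3) : ℝ × V3 →L[ℝ] ℝ × V3 :=
  LinearMap.toContinuousLinearMap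
    { toFun := boost c v
      map_add' := fun p q => by
        ext k
        · simp [boost_eq, dot3, Fin.sum_univ_three]
          ring
        · simp [boost_eq, dot3, Fin.sum_univ_three]
          ring
      map_smul' := fun a p => by
        ext k
        · simp [boost_eq, dot3, Fin.sum_univ_three]
          ring
        · simp [boost_eq, dot3, Fin.sum_univ_three]
          ring }

theorem boostCLM_apply (c : ℝ) (v : V3) (p : ℝ × V3) : boostCLM c v p = boost c v p := rfl

theorem boost_neg_boost {c : ℝ} {v : V3} (hv : norm3 v < c) (p : ℝ × V3) :
    boost c (-v) (boost c v p) = p := by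
  have h1 := boostCoeff_mul (c := c) v
  have h2 := gam_sq_mul hv
  have h3 := boostCoeff_mul_apply hv
  rw [norm3_sq] at h1 h2
  simp only [Fin.sum_univ_three] at h1 h2
  ext k
  · simp only [boost_eq, dot3, Fin.sum_univ_three, gam_neg, Pi.neg_apply, Pi.add_apply,
      Pi.smul_apply, smul_eq_mul]
    linear_combination p.1 * h2
      + gam c v / c ^ 2 * (v 0 * p.2 0 + v 1 * p.2 1 + v 2 * p.2 2) * h1
  · simp only [boost_eq, dot3, Fin.sum_univ_three, gam_neg, boostCoeff_neg, Pi.neg_apply,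
      Pi.add_apply, Pi.smul_apply, smul_eq_mul]
    linear_combination (v 0 * p.2 0 + v 1 * p.2 1 + v 2 * p.2 2) * h3 k
      + (boostCoeff c v * (v 0 * p.2 0 + v 1 * p.2 1 + v 2 * p.2 2) - gam c v * p.1) * v k * h1

namespace smoothFields

/-- The transformed charge density. -/
def chargeTr (c : ℝ) (v : V3) (ρ : smoothFields) (J : Fin 3 → smoothFields) : smoothFields :=
  precomp (boostCLM c (-v)) (gam c v • (ρ - (1 / c ^ 2) • ∑ k, v k • J k))

/-- The components of the transformed current. -/
def currentTr (c : ℝ) (v : V3) (ρ : smoothFields) (J : Fin 3 → smoothFields) (i : Fin 3) :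
    smoothFields :=
  precomp (boostCLM c (-v)) (J i + v i • (boostCoeff c v • ∑ k, v k • J k - gam c v • ρ))

theorem dir_timeVec_precomp_boost (c : ℝ) (v : V3) (f : smoothFields) :
    dir timeVec (precomp (boostCLM c (-v)) f) = precomp (boostCLM c (-v))
      (gam c v • (dir timeVec f + ∑ k, v k • dir (spaceVec k) f)) := by
  rw [dir_precomp, dir_eq, boostCLM_apply, boost_eq]
  congr 1
  simp [timeVec, dot3, gam_neg, Fin.sum_univ_three, smul_smul]

theorem dir_spaceVec_precomp_boost (c : ℝ) (v : V3) (f : smoothFields) (i : Fin 3) :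
    dir (spaceVec i) (precomp (boostCLM c (-v)) f) = precomp (boostCLM c (-v))
      ((gam c v * (1 / c ^ 2) * v i) • dir timeVec f + dir (spaceVec i) f
        + (boostCoeff c v * v i) • ∑ k, v k • dir (spaceVec k) f) := by
  rw [dir_precomp, dir_eq (boostCLM c (-v) _), boostCLM_apply, boost_eq]
  congr 1
  ext p
  fin_cases i <;>
  · simp [spaceVec, dot3, gam_neg, boostCoeff_neg, Fin.sum_univ_three]
    ring

theorem IsClosedCurrent.boost {c : ℝ} {v : V3} (hv : norm3 v < c) {ρ : smoothFields}
    {J : Fin 3 → smoothFields} (h : IsClosedCurrent (1 / c ^ 2) ρ J) :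
    IsClosedCurrent (1 / c ^ 2) (chargeTr c v ρ J) (currentTr c v ρ J) := by
  have h1 := boostCoeff_mul (c := c) v
  have h2 := gam_sq_mul hv
  have h3 := boostCoeff_mul_apply hv
  rw [norm3_sq] at h1 h2
  simp only [Fin.sum_univ_three] at h1 h2
  have h10 := h.curl_eq 1 0
  have h20 := h.curl_eq 2 0
  have h21 := h.curl_eq 2 1
  have hdiv : dir timeVec ρ = -∑ i, dir (spaceVec i) (J i) := by rw [h.div_eq, neg_neg]
  simp only [Fin.sum_univ_three] at hdiv
  have hgrad := h.grad_eq
  refine ⟨fun i k => ?_, fun i => ?_, ?_⟩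
  · simp only [currentTr, dir_spaceVec_precomp_boost]
    congr 1
    fin_cases i <;> fin_cases k <;>
    · simp only [Fin.sum_univ_three, map_add, map_sub, map_smul, hgrad, hdiv, Fin.zero_eta,
        Fin.mk_one, Fin.reduceFinMk, h10, h20, h21]
      try module
  · simp only [currentTr, chargeTr, dir_spaceVec_precomp_boost, dir_timeVec_precomp_boost]
    rw [← map_smul (precomp _), ← map_neg (precomp _)]
    congr 1
    fin_cases i <;>
    · simp only [Fin.sum_univ_three, map_add, map_sub, map_smul, hgrad, hdiv, Fin.zero_eta,
        Fin.mk_one, Fin.reduceFinMk, h10, h20, h21]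
      try module
  · simp only [currentTr, chargeTr, dir_spaceVec_precomp_boost, dir_timeVec_precomp_boost]
    rw [← map_sum (precomp _), ← map_neg (precomp _)]
    congr 1
    simp only [Fin.sum_univ_three, map_add, map_sub, map_smul, hgrad, hdiv, h10, h20, h21]
    match_scalars
    · linear_combination 2 * gam c v * (1 / c ^ 2) * v 0 * h1
    · linear_combination 2 * gam c v * (1 / c ^ 2) * v 1 * h1
    · linear_combination 2 * gam c v * (1 / c ^ 2) * v 2 * h1
    · linear_combination -h2 + v 0 * h3 0 + v 0 ^ 2 * boostCoeff c v * h1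
    · linear_combination -h2 + v 1 * h3 1 + v 1 ^ 2 * boostCoeff c v * h1
    · linear_combination -h2 + v 2 * h3 2 + v 2 ^ 2 * boostCoeff c v * h1
    · linear_combination 2 * v 0 * h3 1 + 2 * v 0 * v 1 * boostCoeff c v * h1
    · linear_combination 2 * v 0 * h3 2 + 2 * v 0 * v 2 * boostCoeff c v * h1
    · linear_combination 2 * v 1 * h3 2 + 2 * v 1 * v 2 * boostCoeff c v * h1

end smoothFields

namespace smoothFields

theorem rhoTr_eq (c : ℝ) (v : V3) (ρ : smoothFields) {J : ℝ × V3 → V3}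
    (hJ : ContDiff ℝ (⊤ : ℕ∞) J) : rhoTr c v ρ J = chargeTr c v ρ (comp hJ) := by
  ext p
  simp [rhoTr, chargeTr, precomp_apply, boostCLM_apply, comp, dot3, Fin.sum_univ_three]
  left
  ring

theorem JTr_apply (c : ℝ) (v : V3) (ρ : smoothFields) {J : ℝ × V3 → V3}
    (hJ : ContDiff ℝ (⊤ : ℕ∞) J) (p : ℝ × V3) (k : Fin 3) :
    JTr c v ρ J p k = (currentTr c v ρ (comp hJ) k : ℝ × V3 → ℝ) p := by
  simp [JTr, currentTr, precomp_apply, boostCLM_apply, boostCoeff, comp, dot3, Fin.sum_univ_three]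
  ring

theorem contDiff_JTr (c : ℝ) (v : V3) (ρ : smoothFields) {J : ℝ × V3 → V3}
    (hJ : ContDiff ℝ (⊤ : ℕ∞) J) : ContDiff ℝ (⊤ : ℕ∞) (JTr c v ρ J) :=
  contDiff_pi.2 fun k =>
    (funext fun p => JTr_apply c v ρ hJ p k : (fun p => JTr c v ρ J p k) = _) ▸ contDiff_coe _

theorem comp_JTr (c : ℝ) (v : V3) (ρ : smoothFields) {J : ℝ × V3 → V3}
    (hJ : ContDiff ℝ (⊤ : ℕ∞) J) :
    comp (contDiff_JTr c v ρ hJ) = currentTr c v ρ (comp hJ) := by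
  ext k p
  exact JTr_apply c v ρ hJ p k

/-- The components of the transformed electric field. -/
def fieldTr (c : ℝ) (v : V3) (E : Fin 3 → smoothFields) (k : Fin 3) : smoothFields :=
  precomp (boostCLM c (-v)) (gam c v • E k
    + ((1 - gam c v) * (norm3 v ^ 2)⁻¹ * v k) • ∑ i, v i • E i)

theorem ETr_apply (c : ℝ) (v : V3) {E : ℝ × V3 → V3}
    (hE : ContDiff ℝ (⊤ : ℕ∞) E) (p : ℝ × V3) (k : Fin 3) :
    ETr c v E p k = (fieldTr c v (comp hE) k : ℝ × V3 → ℝ) p := by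
  simp [ETr, fieldTr, precomp_apply, boostCLM_apply, comp, dot3, Fin.sum_univ_three]
  ring

theorem contDiff_ETr (c : ℝ) (v : V3) {E : ℝ × V3 → V3}
    (hE : ContDiff ℝ (⊤ : ℕ∞) E) : ContDiff ℝ (⊤ : ℕ∞) (ETr c v E) :=
  contDiff_pi.2 fun k =>
    (funext fun p => ETr_apply c v hE p k : (fun p => ETr c v E p k) = _) ▸ contDiff_coe _

theorem comp_ETr (c : ℝ) (v : V3) {E : ℝ × V3 → V3} (hE : ContDiff ℝ (⊤ : ℕ∞) E) :
    comp (contDiff_ETr c v hE) = fieldTr c v (comp hE) := by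
  ext k p
  exact ETr_apply c v hE p k

theorem precomp_boost_mem {c : ℝ} {v : V3} (hv : norm3 v < c) {E : Fin 3 → smoothFields}
    (h : ∀ k, fieldTr c v E k ∈ schwartzFields) (k : Fin 3) :
    precomp (boostCLM c (-v)) (E k) ∈ schwartzFields := by
  have hg := gam_ne_zero hv
  have hsum : ∑ i, v i • fieldTr c v E i = precomp (boostCLM c (-v)) (∑ i, v i • E i) := by
    simp only [fieldTr, ← map_smul, ← map_sum]
    congr 1
    by_cases h0 : norm3 v = 0
    · simp [eq_zero_of_norm3_eq_zero h0]
    · have h1 : (norm3 v ^ 2)⁻¹ * (v 0 ^ 2 + v 1 ^ 2 + v 2 ^ 2) = 1 := by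
        rw [← Fin.sum_univ_three (fun i => v i ^ 2), ← norm3_sq,
          inv_mul_cancel₀ (by simpa using h0)]
      simp only [Fin.sum_univ_three]
      match_scalars
      · linear_combination (1 - gam c v) * v 0 * h1
      · linear_combination (1 - gam c v) * v 1 * h1
      · linear_combination (1 - gam c v) * v 2 * h1
  have hk : precomp (boostCLM c (-v)) (E k) = (gam c v)⁻¹ • (fieldTr c v E k
      - ((1 - gam c v) * (norm3 v ^ 2)⁻¹ * v k) • ∑ i, v i • fieldTr c v E i) := by
    rw [hsum, fieldTr, ← map_smul (precomp _), ← map_sub (precomp _), ← map_smul (precomp _),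
      add_sub_cancel_right, inv_smul_smul₀ hg]
  rw [hk]
  exact Submodule.smul_mem _ _ (Submodule.sub_mem _ (h k) (Submodule.smul_mem _ _
    (Submodule.sum_mem _ fun i _ => Submodule.smul_mem _ _ (h i))))

theorem precomp_boost_dir_mem {c : ℝ} {v : V3} (hv : norm3 v < c) {f : smoothFields}
    (hf : precomp (boostCLM c (-v)) f ∈ schwartzFields) (w : ℝ × V3) :
    precomp (boostCLM c (-v)) (dir w f) ∈ schwartzFields := by
  have h := dir_mem hf (boost c v w)
  rwa [dir_precomp, boostCLM_apply, boost_neg_boost hv] at h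

theorem chargeTr_mem {c ε₀ : ℝ} {v : V3} (hv : norm3 v < c) {ρ : smoothFields}
    {J E : Fin 3 → smoothFields} (hρ : ρ = ε₀ • ∑ i, dir (spaceVec i) (E i))
    (hJ : ∀ k, J k = -(ε₀ • dir timeVec (E k)))
    (h : ∀ k, fieldTr c v E k ∈ schwartzFields) : chargeTr c v ρ J ∈ schwartzFields := by
  have hE := precomp_boost_mem hv h
  simp only [chargeTr, hρ, hJ, map_smul, map_sub, map_sum, map_neg]
  exact Submodule.smul_mem _ _ (Submodule.sub_mem _
    (Submodule.smul_mem _ _ (Submodule.sum_mem _ fun i _ => precomp_boost_dir_mem hv (hE i) _))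
    (Submodule.smul_mem _ _ (Submodule.sum_mem _ fun i _ => Submodule.smul_mem _ _
      (Submodule.neg_mem _ (Submodule.smul_mem _ _ (precomp_boost_dir_mem hv (hE i) _))))))

/-- The sources of a curl-free electric field that satisfies the wave equation form a closed
current. -/
theorem isClosedCurrent_of_field {κ ε₀ : ℝ} {ρ : smoothFields} {J E : Fin 3 → smoothFields}
    (hρ : ρ = ε₀ • ∑ i, dir (spaceVec i) (E i)) (hJ : ∀ k, J k = -(ε₀ • dir timeVec (E k)))
    (hcurl : ∀ i k, dir (spaceVec i) (E k) = dir (spaceVec k) (E i))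
    (hwave : ∀ k, dalembertian κ (E k) = 0) : IsClosedCurrent κ ρ J where
  curl_eq i k := by
    rw [hJ, hJ, map_neg, map_neg, map_smul, map_smul, dir_dir_comm, hcurl, dir_dir_comm]
  grad_eq i := by
    have h := hwave i
    rw [dalembertian_apply, sub_eq_zero] at h
    have h1 : dir (spaceVec i) (∑ l, dir (spaceVec l) (E l)) =
        ∑ l, dir (spaceVec l) (dir (spaceVec l) (E i)) := by
      rw [map_sum]
      exact Finset.sum_congr rfl fun l _ => by rw [dir_dir_comm, hcurl]
    rw [hρ, map_smul, h1, h, hJ, map_neg, map_smul, smul_neg, neg_neg, smul_comm]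
  div_eq := by
    simp only [hρ, hJ, map_neg, map_smul, map_sum, Finset.sum_neg_distrib, ← Finset.smul_sum,
      dir_dir_comm timeVec]

theorem curl_zero (p : ℝ × V3) : curl (fun _ => 0) p = 0 := by
  ext k
  fin_cases k <;> simp [curl, pxd]

/-- The electric field and current form of Maxwell's equations without magnetic field. -/
theorem maxwell_zero_iff {ε₀ μ₀ : ℝ} (hε : ε₀ ≠ 0) (hμ : μ₀ ≠ 0) (ρ : smoothFields)
    {J E : ℝ × V3 → V3} (hJ : ContDiff ℝ (⊤ : ℕ∞) J) (hE : ContDiff ℝ (⊤ : ℕ∞) E) :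
    Maxwell ε₀ μ₀ ρ J E (fun _ => 0) ↔
      ρ = ε₀ • ∑ i, dir (spaceVec i) (comp hE i) ∧
      (∀ k, comp hJ k = -(ε₀ • dir timeVec (comp hE k))) ∧
      ∀ i k, dir (spaceVec i) (comp hE k) = dir (spaceVec k) (comp hE i) := by
  have h0 : ∀ p, divg (fun _ => 0) p = 0 := fun p => by simp [divg, pxd]
  have h1 : ∀ p, ptd (fun _ : ℝ × V3 => (0 : V3)) p = 0 := fun p => by simp [ptd]
  have hamp : ∀ k p, 0 = μ₀ * J p k + μ₀ * ε₀ * ptd E p k ↔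
      (comp hJ k : ℝ × V3 → ℝ) p = -(ε₀ * (dir timeVec (comp hE k) : ℝ × V3 → ℝ) p) :=
    fun k p => by
    rw [ptd_apply hE, mul_assoc, ← mul_add, eq_comm, mul_eq_zero_iff_left hμ,
      ← eq_neg_iff_add_eq_zero]
    rfl
  rw [← curl_eq_zero_iff hE]
  simp only [Maxwell, h0, h1, curl_zero, neg_zero, divg_apply hE, true_and]
  constructor
  · intro h
    refine ⟨?_, fun k => ?_, fun p => (h p).2.1⟩
    · ext p
      have := (h p).1
      change _ = ε₀ * (∑ i, dir (spaceVec i) (comp hE i) : smoothFields).1 p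
      rw [this, mul_div_cancel₀ _ hε]
    · ext p
      exact (hamp k p).1 (congrFun (h p).2.2 k)
  · rintro ⟨hρ, hJE, hcurl⟩ p
    refine ⟨?_, hcurl p, funext fun k => (hamp k p).2 (congrArg (fun f => f.1 p) (hJE k))⟩
    rw [hρ]
    change _ = ε₀ * (∑ i, dir (spaceVec i) (comp hE i) : smoothFields).1 p / ε₀
    rw [mul_div_cancel_left₀ _ hε]

end smoothFields

/-- if `(ρ, J, E, B)` satisfies the conclusions of the
wave-equation lemma in the rest frame (Maxwell, `B = 0`, `□²E = 0`, `□²ρ = 0`,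
`□²J = 0`, `curl J = 0`), with `E` bounded, vanishing at infinity, and with
transformed field `E''_v` Schwartz in space locally uniformly in time, then in
the inertial frame with velocity `v` the transformed charge and current
`(ρ'_v, J'_v)` extend to fields `(E', B')` satisfying Maxwell's equations with
`B' = 0` and `□²E' = 0`; moreover `□²ρ'_v = 0`, `□²J'_v = 0`, `curl J'_v = 0`. -/
theorem stmt_10 (ε₀ μ₀ c : ℝ) (hε : 0 < ε₀) (hμ : 0 < μ₀)
    (hc : c = 1 / Real.sqrt (μ₀ * ε₀))
    (ρ : ℝ × V3 → ℝ) (J E B : ℝ × V3 → V3)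
    (hρ : ContDiff ℝ (⊤ : ℕ∞) ρ) (hJ : ContDiff ℝ (⊤ : ℕ∞) J)
    (hEsm : ContDiff ℝ (⊤ : ℕ∞) E) (hBsm : ContDiff ℝ (⊤ : ℕ∞) B)
    (hM : Maxwell ε₀ μ₀ ρ J E B)
    (hB0 : ∀ p : ℝ × V3, B p = 0)
    (hwE : ∀ p : ℝ × V3, box μ₀ ε₀ E p = 0)
    (hwρ : ∀ p : ℝ × V3, box μ₀ ε₀ ρ p = 0)
    (hwJ : ∀ p : ℝ × V3, box μ₀ ε₀ J p = 0)
    (hcurlJ : ∀ p : ℝ × V3, curl J p = 0)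
    (v : V3) (hv : norm3 v < c)
    (hEbd : ∃ C : ℝ, ∀ p : ℝ × V3, ‖E p‖ ≤ C)
    (hEdecay : Filter.Tendsto E (Filter.cocompact (ℝ × V3)) (nhds 0))
    (hESch : SchwartzLocUnif (ETr c v E)) :
    (∃ E' B' : ℝ × V3 → V3,
      ContDiff ℝ (⊤ : ℕ∞) E' ∧ ContDiff ℝ (⊤ : ℕ∞) B' ∧
      Maxwell ε₀ μ₀ (rhoTr c v ρ J) (JTr c v ρ J) E' B' ∧
      (∀ p : ℝ × V3, B' p = 0) ∧
      (∀ p : ℝ × V3, box μ₀ ε₀ E' p = 0)) ∧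
    (∀ p : ℝ × V3, box μ₀ ε₀ (rhoTr c v ρ J) p = 0) ∧
    (∀ p : ℝ × V3, box μ₀ ε₀ (JTr c v ρ J) p = 0) ∧
    (∀ p : ℝ × V3, curl (JTr c v ρ J) p = 0) := by
  obtain rfl : B = fun _ => 0 := funext hB0
  obtain ⟨ρ, rfl⟩ : ∃ f : smoothFields, (f : ℝ × V3 → ℝ) = ρ := ⟨⟨ρ, hρ⟩, rfl⟩
  obtain ⟨hρE, hJE, hcurlE⟩ :=
    (smoothFields.maxwell_zero_iff hε.ne' hμ.ne' ρ hJ hEsm).1 hM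
  have hκ : μ₀ * ε₀ = 1 / c ^ 2 := by
    rw [hc, div_pow, one_pow, one_div_one_div, Real.sq_sqrt (mul_pos hμ hε).le]
  have hcl : smoothFields.IsClosedCurrent (1 / c ^ 2) (smoothFields.chargeTr c v ρ _) _ :=
    (smoothFields.isClosedCurrent_of_field hρE hJE hcurlE fun k => by
      ext p
      rw [← hκ, ← smoothFields.box_apply, hwE]
      rfl).boost hv
  have hmem : smoothFields.chargeTr c v ρ (smoothFields.comp hJ) ∈ smoothFields.schwartzFields :=
    smoothFields.chargeTr_mem hv hρE hJE fun k => by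
      rw [← smoothFields.comp_ETr]
      exact smoothFields.comp_mem_schwartzFields _ hESch k
  obtain ⟨u, hu, hu0⟩ := smoothFields.exists_potential (Submodule.smul_mem _ ε₀⁻¹ hmem) 0
  obtain ⟨E', hdiv, hcurl, hJE', hwave⟩ := hcl.exists_field hε.ne' hu hu0
  rw [← hκ] at hcl hwave
  have hsm : ContDiff ℝ (⊤ : ℕ∞) (fun p k => (E' k : ℝ × V3 → ℝ) p) :=
    contDiff_pi.2 fun k => smoothFields.contDiff_coe (E' k)
  have hJsm := smoothFields.contDiff_JTr c v ρ hJ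
  have hJc := smoothFields.comp_JTr c v ρ hJ
  rw [smoothFields.rhoTr_eq c v ρ hJ]
  refine ⟨⟨_, fun _ => 0, hsm, contDiff_const, ?_, fun _ => rfl, fun p => ?_⟩, fun p => ?_,
    fun p => ?_, ?_⟩
  · refine (smoothFields.maxwell_zero_iff hε.ne' hμ.ne' _ hJsm hsm).2 ⟨?_, fun k => ?_, hcurl⟩
    · exact (inv_smul_eq_iff₀ hε.ne').1 hdiv.symm
    · rw [hJc]
      exact hJE' k
  · ext k
    rw [smoothFields.box_apply μ₀ ε₀ hsm]
    exact congrArg (fun f => f.1 p) (hwave k)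
  · rw [smoothFields.box_coe, hcl.dalembertian_charge]
    rfl
  · ext k
    rw [smoothFields.box_apply μ₀ ε₀ hJsm, hJc, hcl.dalembertian_current]
    rfl
  · rw [smoothFields.curl_eq_zero_iff hJsm, hJc]
    exact hcl.curl_eq
end
end

section
/- With ρ and J given by the plane-wave representation with Schwartz coefficients f, g, F, G: (a) if ∇ρ + (1/c²) ∂J/∂t = 0 at every point of ℝ × ℝ³, then for every k ∈ ℝ³ with k ≠ 0, F(k) = c f(k) k/|k| and G(k) = −c g(k) k/|k|; (b) if the continuity equation ∂ρ/∂t + div J = 0 holds at every point, then for every k ≠ 0, f(k) = (k·F(k))/(c|k|) and g(k) = −(k·G(k))/(c|k|). -/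
noncomputable section

open Real MeasureTheory Filter

/-- Scalar plane-wave representation
`ρ(t,x) = ∫ f(k) e^{i(k·x - c|k|t)} dk + ∫ g(k) e^{i(k·x + c|k|t)} dk`. -/
def pwScalar (c : ℝ) (f g : V3 → ℂ) : ℝ × V3 → ℂ :=
  fun p =>
    (∫ k : V3, f k * Complex.exp (Complex.I * ((dot3 k p.2 - c * norm3 k * p.1 : ℝ) : ℂ))) +
    (∫ k : V3, g k * Complex.exp (Complex.I * ((dot3 k p.2 + c * norm3 k * p.1 : ℝ) : ℂ)))

/-- Vector plane-wave representation
`J(t,x) = ∫ F(k) e^{i(k·x - c|k|t)} dk + ∫ G(k) e^{i(k·x + c|k|t)} dk`. -/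
def pwVec (c : ℝ) (F G : V3 → Fin 3 → ℂ) : ℝ × V3 → Fin 3 → ℂ :=
  fun p =>
    (∫ k : V3, Complex.exp (Complex.I * ((dot3 k p.2 - c * norm3 k * p.1 : ℝ) : ℂ)) • F k) +
    (∫ k : V3, Complex.exp (Complex.I * ((dot3 k p.2 + c * norm3 k * p.1 : ℝ) : ℂ)) • G k)

lemma norm3_eq_norm_toLp (k : V3) : norm3 k = ‖WithLp.toLp 2 k‖ := by
  simp [norm3, EuclideanSpace.norm_eq]

@[fun_prop]
lemma continuous_norm3 : Continuous norm3 := by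
  unfold norm3; fun_prop

lemma norm3_nonneg (k : V3) : 0 ≤ norm3 k := Real.sqrt_nonneg _

lemma norm3_pos {k : V3} (hk : k ≠ 0) : 0 < norm3 k := by
  rw [norm3_eq_norm_toLp]
  exact norm_pos_iff.2 (by simpa using hk)

lemma norm3_le (k : V3) : norm3 k ≤ 3 * ‖k‖ := by
  refine Real.sqrt_le_iff.2 ⟨by positivity, ?_⟩
  have h : ∀ i, k i ^ 2 ≤ ‖k‖ ^ 2 := fun i => by
    rw [← sq_abs]
    exact pow_le_pow_left₀ (abs_nonneg _) (norm_le_pi_norm k i) 2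
  calc ∑ i, k i ^ 2 ≤ ∑ _i : Fin 3, ‖k‖ ^ 2 := Finset.sum_le_sum fun i _ => h i
    _ ≤ (3 * ‖k‖) ^ 2 := by simp; nlinarith [sq_nonneg ‖k‖]

/-- The phase `k·x + σ|k|t` as a linear functional of `(t, x)`. -/
def phase (σ : ℝ) (k : V3) : ℝ × V3 →L[ℝ] ℝ :=
  (∑ i, k i • ContinuousLinearMap.proj (R := ℝ) (φ := fun _ : Fin 3 => ℝ) i).comp
    (ContinuousLinearMap.snd ℝ ℝ V3) + (σ * norm3 k) • ContinuousLinearMap.fst ℝ ℝ V3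

lemma phase_apply (σ : ℝ) (k : V3) (p : ℝ × V3) :
    phase σ k p = dot3 k p.2 + σ * norm3 k * p.1 := by
  simp [phase, dot3]

lemma continuous_phase (σ : ℝ) : Continuous (phase σ) := by
  unfold phase; fun_prop

lemma norm_phase_le (σ : ℝ) (k : V3) : ‖phase σ k‖ ≤ 3 * (1 + |σ|) * ‖k‖ := by
  refine ContinuousLinearMap.opNorm_le_bound _ (by positivity) fun p => ?_
  rw [phase_apply, Real.norm_eq_abs]
  have hdot : |dot3 k p.2| ≤ 3 * ‖k‖ * ‖p‖ := by
    calc |dot3 k p.2| ≤ ∑ i, |k i * p.2 i| := Finset.abs_sum_le_sum_abs _ _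
      _ ≤ ∑ _i : Fin 3, ‖k‖ * ‖p‖ := Finset.sum_le_sum fun i _ => by
          rw [abs_mul]
          exact mul_le_mul (norm_le_pi_norm k i)
            ((norm_le_pi_norm p.2 i).trans (norm_snd_le p)) (abs_nonneg _) (norm_nonneg _)
      _ = 3 * ‖k‖ * ‖p‖ := by simp; ring
  have htime : |σ * norm3 k * p.1| ≤ |σ| * (3 * ‖k‖) * ‖p‖ := by
    rw [abs_mul, abs_mul, abs_of_nonneg (norm3_nonneg k)]
    have := norm3_le k
    have := norm_fst_le p
    have := norm3_nonneg k
    rw [Real.norm_eq_abs] at *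
    gcongr
  calc _ ≤ _ := abs_add_le _ _
    _ ≤ 3 * (1 + |σ|) * ‖k‖ * ‖p‖ := by linarith

/-- The elementary wave `e^{i(k·x + σ|k|t)}`. -/
def wave (σ : ℝ) (p : ℝ × V3) (k : V3) : ℂ := Complex.exp (Complex.I * (phase σ k p : ℂ))

lemma norm_wave (σ : ℝ) (p : ℝ × V3) (k : V3) : ‖wave σ p k‖ = 1 := by
  rw [wave, mul_comm, Complex.norm_exp_ofReal_mul_I]

lemma continuous_wave (σ : ℝ) (p : ℝ × V3) : Continuous (wave σ p) := by
  have h : Continuous fun k => phase σ k p := (continuous_phase σ).clm_apply continuous_const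
  unfold wave; fun_prop

lemma wave_eq_mul (σ : ℝ) (p : ℝ × V3) (k : V3) :
    wave σ p k = Complex.exp (Complex.I * (σ * norm3 k * p.1 : ℝ)) *
      Complex.exp (Complex.I * (dot3 k p.2 : ℝ)) := by
  rw [wave, phase_apply, ← Complex.exp_add]
  push_cast
  ring_nf

lemma MeasureTheory.Integrable.mul_wave {h : V3 → ℂ} (hh : Integrable h) (σ : ℝ)
    (p : ℝ × V3) : Integrable fun k => h k * wave σ p k :=
  hh.mul_bdd (c := 1) (continuous_wave σ p).aestronglyMeasurable
    (ae_of_all _ fun k => (norm_wave σ p k).le)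

lemma SchwartzMap.integrable_mul_of_norm_le (f : SchwartzMap V3 ℂ) {a : V3 → ℂ}
    (ha : Continuous a) {C : ℝ} (hC : ∀ k, ‖a k‖ ≤ C * ‖k‖) :
    Integrable fun k => a k * f k := by
  refine ((f.integrable_pow_mul volume 1).const_mul C).mono'
    (ha.mul f.continuous).aestronglyMeasurable (ae_of_all _ fun k => ?_)
  rw [norm_mul, pow_one, ← mul_assoc]
  exact mul_le_mul_of_nonneg_right (hC k) (norm_nonneg _)

lemma SchwartzMap.integrable_phase_mul (f : SchwartzMap V3 ℂ) (σ : ℝ) (v : ℝ × V3) :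
    Integrable fun k => (Complex.I * (phase σ k v : ℂ)) * f k := by
  have h : Continuous fun k => phase σ k v := (continuous_phase σ).clm_apply continuous_const
  refine f.integrable_mul_of_norm_le (C := 3 * (1 + |σ|) * ‖v‖) (by fun_prop) fun k => ?_
  rw [norm_mul, Complex.norm_I, one_mul, Complex.norm_real]
  calc _ ≤ _ := (phase σ k).le_opNorm v
    _ ≤ 3 * (1 + |σ|) * ‖k‖ * ‖v‖ :=
        mul_le_mul_of_nonneg_right (norm_phase_le σ k) (norm_nonneg _)
    _ = _ := by ring

/-- Derivative of a superposition of waves, by differentiation under the integral sign. -/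
lemma exists_hasFDerivAt_integral_wave (σ : ℝ) (f : SchwartzMap V3 ℂ) (p : ℝ × V3) :
    ∃ D : ℝ × V3 →L[ℝ] ℂ, HasFDerivAt (fun q => ∫ k, f k * wave σ q k) D p ∧
      ∀ v, D v = ∫ k, (Complex.I * (phase σ k v : ℂ)) * f k * wave σ p k := by
  let F' : ℝ × V3 → V3 → (ℝ × V3 →L[ℝ] ℂ) := fun q k =>
    (phase σ k).smulRight (Complex.I * f k * wave σ q k)
  have hF'c : ∀ q, Continuous (F' q) := fun q => by
    have h1 := continuous_phase σ
    have h2 := continuous_wave σ q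
    have h3 := f.continuous
    exact (ContinuousLinearMap.smulRightL ℝ (ℝ × V3) ℂ).continuous₂.comp
      (h1.prodMk (by fun_prop : Continuous fun k => Complex.I * f k * wave σ q k))
  have hbound : ∀ q k, ‖F' q k‖ ≤ 3 * (1 + |σ|) * (‖k‖ ^ 1 * ‖f k‖) := fun q k => by
    simp only [F', ContinuousLinearMap.norm_smulRight_apply, norm_mul, Complex.norm_I,
      norm_wave, one_mul, mul_one, pow_one]
    rw [← mul_assoc]
    exact mul_le_mul_of_nonneg_right (norm_phase_le σ k) (norm_nonneg _)
  have hint := (f.integrable_pow_mul volume 1).const_mul (3 * (1 + |σ|))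
  refine ⟨∫ k, F' p k, hasFDerivAt_integral_of_dominated_of_fderiv_le (s := Set.univ)
    (bound := fun k => 3 * (1 + |σ|) * (‖k‖ ^ 1 * ‖f k‖)) univ_mem ?_ ?_ ?_ ?_ hint ?_, ?_⟩
  · exact Eventually.of_forall fun q =>
      (f.continuous.mul (continuous_wave σ q)).aestronglyMeasurable
  · exact f.integrable.mul_wave σ p
  · exact (hF'c p).aestronglyMeasurable
  · exact ae_of_all _ fun k q _ => hbound q k
  · refine ae_of_all _ fun k q _ => ?_
    have h := (((Complex.ofRealCLM.hasFDerivAt.comp q (phase σ k).hasFDerivAt).const_mul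
      Complex.I).cexp.const_mul (f k))
    refine h.congr_fderiv ?_
    ext v <;> simp [F', wave] <;> ring
  · intro v
    rw [ContinuousLinearMap.integral_apply
      (hint.mono' (hF'c p).aestronglyMeasurable (ae_of_all _ (hbound p)))]
    refine integral_congr_ae (ae_of_all _ fun k => ?_)
    simp [F']
    ring

/-- A continuous integrable function on `ℝ³` whose Fourier transform vanishes is zero. -/
lemma eq_zero_of_integral_mul_exp_eq_zero {h : V3 → ℂ} (hc : Continuous h)
    (hi : Integrable h)
    (h0 : ∀ x : V3, ∫ k, h k * Complex.exp (Complex.I * (dot3 k x : ℝ)) = 0) : h = 0 := by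
  let H : EuclideanSpace ℝ (Fin 3) → ℂ := fun k => h k.ofLp
  have hHc : Continuous H := by fun_prop
  have hHi : Integrable H :=
    (PiLp.volume_preserving_ofLp (Fin 3)).integrable_comp_of_integrable hi
  have hF : FourierTransform.fourier H = 0 := by
    ext w
    rw [Real.fourier_eq', Pi.zero_apply, ← h0 (fun i => -2 * π * w i),
      ← (PiLp.volume_preserving_ofLp (Fin 3)).integral_comp
        (MeasurableEquiv.toLp 2 (Fin 3 → ℝ)).symm.measurableEmbedding]
    refine integral_congr_ae (ae_of_all _ fun k => ?_)
    simp only [H, smul_eq_mul]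
    rw [mul_comm, mul_comm Complex.I]
    congr 4
    simp only [dot3, PiLp.inner_apply, Finset.mul_sum]
    refine Finset.sum_congr rfl fun i _ => ?_
    simp
    ring
  have hinv := hHc.fourierInv_fourier_eq hHi (by rw [hF]; exact integrable_zero _ _ _)
  funext k
  have := congrFun hinv (WithLp.toLp 2 k)
  rw [hF] at this
  rw [show h k = H (WithLp.toLp 2 k) from rfl, ← this, Real.fourierInv_eq]
  simp

/-- Waves of opposite time frequencies are independent: a vanishing superposition has vanishing
amplitudes away from the zero frequency. -/
lemma amplitudes_eq_zero {c : ℝ} (hc : 0 < c) {A B : V3 → ℂ} (hA : Continuous A)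
    (hB : Continuous B) (hAi : Integrable A) (hBi : Integrable B)
    (h : ∀ p : ℝ × V3, (∫ k, A k * wave (-c) p k) + ∫ k, B k * wave c p k = 0)
    {k : V3} (hk : k ≠ 0) : A k = 0 ∧ B k = 0 := by
  have key : ∀ t : ℝ, A k * Complex.exp (Complex.I * (-c * norm3 k * t : ℝ)) +
      B k * Complex.exp (Complex.I * (c * norm3 k * t : ℝ)) = 0 := fun t => by
    refine congrFun (eq_zero_of_integral_mul_exp_eq_zero (h := fun k =>
      A k * Complex.exp (Complex.I * (-c * norm3 k * t : ℝ)) +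
      B k * Complex.exp (Complex.I * (c * norm3 k * t : ℝ))) (by fun_prop) ?_ fun x => ?_) k
    · have h1 := hAi.mul_wave (-c) (t, 0)
      have h2 := hBi.mul_wave c (t, 0)
      refine (h1.add h2).congr (ae_of_all _ fun k => ?_)
      simp [wave_eq_mul, dot3]
    · rw [← h (t, x), ← integral_add (hAi.mul_wave _ _) (hBi.mul_wave _ _)]
      refine integral_congr_ae (ae_of_all _ fun k => ?_)
      simp only [wave_eq_mul]
      ring
  have hn := (norm3_pos hk).ne'
  have h0 : A k + B k = 0 := by simpa using key 0
  have h1 : B k - A k = 0 := by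
    have h2 := key (π / 2 / (c * norm3 k))
    rw [show -c * norm3 k * (π / 2 / (c * norm3 k)) = -(π / 2) by field_simp,
      show c * norm3 k * (π / 2 / (c * norm3 k)) = π / 2 by field_simp] at h2
    rw [mul_comm Complex.I, mul_comm Complex.I, Complex.exp_mul_I, Complex.exp_mul_I,
      ← Complex.ofReal_cos, ← Complex.ofReal_sin, ← Complex.ofReal_cos, ← Complex.ofReal_sin,
      Real.cos_neg, Real.sin_neg, Real.cos_pi_div_two, Real.sin_pi_div_two] at h2
    have h3 : (B k - A k) * Complex.I = 0 := by
      rw [← h2]; push_cast; ring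
    exact (mul_eq_zero.1 h3).resolve_right Complex.I_ne_zero
  constructor
  · linear_combination (h0 - h1) / 2
  · linear_combination (h0 + h1) / 2

lemma pwScalar_eq (c : ℝ) (f g : V3 → ℂ) :
    pwScalar c f g = fun p => (∫ k, f k * wave (-c) p k) + ∫ k, g k * wave c p k := by
  funext p
  simp only [pwScalar, wave, phase_apply, neg_mul, sub_eq_add_neg]

lemma exists_hasFDerivAt_pwScalar (c : ℝ) (f g : SchwartzMap V3 ℂ) (p : ℝ × V3) :
    ∃ D : ℝ × V3 →L[ℝ] ℂ, HasFDerivAt (pwScalar c f g) D p ∧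
      ∀ v, D v = (∫ k, (Complex.I * (phase (-c) k v : ℂ)) * f k * wave (-c) p k) +
        ∫ k, (Complex.I * (phase c k v : ℂ)) * g k * wave c p k := by
  obtain ⟨D₁, h₁, e₁⟩ := exists_hasFDerivAt_integral_wave (-c) f p
  obtain ⟨D₂, h₂, e₂⟩ := exists_hasFDerivAt_integral_wave c g p
  refine ⟨D₁ + D₂, ?_, fun v => by simp [e₁, e₂]⟩
  rw [pwScalar_eq]
  exact h₁.add h₂

lemma hasDerivAt_time_slice {u : ℝ × V3 → ℂ} {D : ℝ × V3 →L[ℝ] ℂ} {p : ℝ × V3}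
    (h : HasFDerivAt u D p) : HasDerivAt (fun s => u (s, p.2)) (D (1, 0)) p.1 :=
  h.comp_hasDerivAt (f := fun s => (s, p.2)) p.1
    ((hasDerivAt_id p.1).prodMk (hasDerivAt_const p.1 p.2))

lemma pxd_eq_of_hasFDerivAt {u : ℝ × V3 → ℂ} {D : ℝ × V3 →L[ℝ] ℂ} {p : ℝ × V3}
    (h : HasFDerivAt u D p) (i : Fin 3) : pxd i u p = D (0, Pi.single i 1) := by
  have h' : HasFDerivAt (fun y => u (p.1, y))
      (D.comp ((0 : V3 →L[ℝ] ℝ).prod (ContinuousLinearMap.id ℝ V3))) p.2 :=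
    HasFDerivAt.comp (f := fun y => (p.1, y)) p.2 h
      ((hasFDerivAt_const p.1 p.2).prodMk (hasFDerivAt_id p.2))
  rw [pxd, h'.fderiv]
  simp

lemma hasDerivAt_pwScalar (c : ℝ) (f g : SchwartzMap V3 ℂ) (p : ℝ × V3) :
    HasDerivAt (fun s => pwScalar c f g (s, p.2))
      ((∫ k, (Complex.I * (phase (-c) k (1, 0) : ℂ)) * f k * wave (-c) p k) +
        ∫ k, (Complex.I * (phase c k (1, 0) : ℂ)) * g k * wave c p k) p.1 := by
  obtain ⟨D, h, e⟩ := exists_hasFDerivAt_pwScalar c f g p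
  rw [← e]
  exact hasDerivAt_time_slice h

lemma pxd_pwScalar (c : ℝ) (f g : SchwartzMap V3 ℂ) (p : ℝ × V3) (i : Fin 3) :
    pxd i (pwScalar c f g) p =
      (∫ k, (Complex.I * (phase (-c) k (0, Pi.single i 1) : ℂ)) * f k * wave (-c) p k) +
        ∫ k, (Complex.I * (phase c k (0, Pi.single i 1) : ℂ)) * g k * wave c p k := by
  obtain ⟨D, h, e⟩ := exists_hasFDerivAt_pwScalar c f g p
  rw [← e, pxd_eq_of_hasFDerivAt h]

/-- The `i`-th component of a vector-valued Schwartz function. -/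
def SchwartzMap.component (F : SchwartzMap V3 (Fin 3 → ℂ)) (i : Fin 3) : SchwartzMap V3 ℂ :=
  SchwartzMap.postcompCLM
    (ContinuousLinearMap.proj (R := ℝ) (φ := fun _ : Fin 3 => ℂ) i) F

lemma SchwartzMap.component_apply (F : SchwartzMap V3 (Fin 3 → ℂ)) (i : Fin 3) (k : V3) :
    F.component i k = F k i := rfl

lemma pwVec_apply (c : ℝ) (F G : SchwartzMap V3 (Fin 3 → ℂ)) (p : ℝ × V3) (i : Fin 3) :
    pwVec c F G p i = pwScalar c (F.component i) (G.component i) p := by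
  have key : ∀ (σ : ℝ) (F : SchwartzMap V3 (Fin 3 → ℂ)),
      (∫ k, wave σ p k • F k) i = ∫ k, F.component i k * wave σ p k := fun σ F => by
    rw [eval_integral]
    · simp [SchwartzMap.component_apply, mul_comm]
    · intro j
      simpa [SchwartzMap.component_apply, mul_comm] using
        (F.component j).integrable.mul_wave σ p
  rw [pwScalar_eq]
  simp only [← key]
  simp only [pwVec, wave, phase_apply, neg_mul, sub_eq_add_neg, Pi.add_apply]

lemma ptd_pwVec_apply (c : ℝ) (F G : SchwartzMap V3 (Fin 3 → ℂ)) (p : ℝ × V3) (i : Fin 3) :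
    ptd (pwVec c F G) p i =
      (∫ k, (Complex.I * (phase (-c) k (1, 0) : ℂ)) * F.component i k * wave (-c) p k) +
        ∫ k, (Complex.I * (phase c k (1, 0) : ℂ)) * G.component i k * wave c p k := by
  have h := hasDerivAt_pi.2 fun j => by
    simpa only [← pwVec_apply] using
      hasDerivAt_pwScalar c (F.component j) (G.component j) p
  rw [ptd, h.deriv]

lemma phase_time (σ : ℝ) (k : V3) : phase σ k (1, 0) = σ * norm3 k := by
  simp [phase_apply, dot3]

lemma phase_space (σ : ℝ) (k : V3) (i : Fin 3) : phase σ k (0, Pi.single i 1) = k i := by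
  simp [phase_apply, dot3, Pi.single_apply]

/-- for plane-wave charge/current pairs with Schwartz
coefficients, (a) the relation `∇ρ + (1/c²)∂J/∂t = 0` forces
`F(k) = c f(k) k/|k|` and `G(k) = -c g(k) k/|k|`; (b) the continuity equation
forces `f(k) = (k·F(k))/(c|k|)` and `g(k) = -(k·G(k))/(c|k|)` (for `k ≠ 0`). -/
theorem stmt_16 (c : ℝ) (hc : 0 < c)
    (f g : SchwartzMap V3 ℂ) (F G : SchwartzMap V3 (Fin 3 → ℂ)) :
    ((∀ p : ℝ × V3,
        gradC (pwScalar c f g) p + ((c : ℂ) ^ 2)⁻¹ • ptd (pwVec c F G) p = 0) →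
      ∀ k : V3, k ≠ 0 →
        (∀ i : Fin 3, F k i = ((c * k i / norm3 k : ℝ) : ℂ) * f k) ∧
        (∀ i : Fin 3, G k i = -(((c * k i / norm3 k : ℝ) : ℂ) * g k))) ∧
    ((∀ p : ℝ × V3, ptd (pwScalar c f g) p + divgC (pwVec c F G) p = 0) →
      ∀ k : V3, k ≠ 0 →
        f k = ((c * norm3 k : ℝ) : ℂ)⁻¹ * ∑ i : Fin 3, (k i : ℂ) * F k i ∧
        g k = -(((c * norm3 k : ℝ) : ℂ)⁻¹ * ∑ i : Fin 3, (k i : ℂ) * G k i)) := by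
  have hc0 : (c : ℂ) ≠ 0 := by exact_mod_cast hc.ne'
  have hphase : ∀ (σ : ℝ) (v : ℝ × V3), Continuous fun k => phase σ k v := fun σ v =>
    (continuous_phase σ).clm_apply continuous_const
  refine ⟨fun h k hk => ?_, fun h k hk => ?_⟩
  · have hn : (norm3 k : ℂ) ≠ 0 := by exact_mod_cast (norm3_pos hk).ne'
    rw [← forall_and]
    intro i
    let amp : ℝ → SchwartzMap V3 ℂ → SchwartzMap V3 (Fin 3 → ℂ) → V3 → ℂ := fun σ f F k =>
      (Complex.I * (phase σ k (0, Pi.single i 1) : ℂ)) * f k +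
        ((c : ℂ) ^ 2)⁻¹ * ((Complex.I * (phase σ k (1, 0) : ℂ)) * F.component i k)
    have hcont : ∀ σ f F, Continuous (amp σ f F) := fun σ f F => by
      have h1 := hphase σ (0, Pi.single i 1)
      have h2 := hphase σ (1, 0)
      fun_prop
    have hint : ∀ σ f F, Integrable (amp σ f F) := fun σ f F =>
      (f.integrable_phase_mul σ _).add (((F.component i).integrable_phase_mul σ _).const_mul _)
    have hsplit : ∀ σ f F p, ∫ k, amp σ f F k * wave σ p k =
        (∫ k, (Complex.I * (phase σ k (0, Pi.single i 1) : ℂ)) * f k * wave σ p k) +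
        ((c : ℂ) ^ 2)⁻¹ *
          ∫ k, (Complex.I * (phase σ k (1, 0) : ℂ)) * F.component i k * wave σ p k :=
      fun σ f F p => by
        rw [← integral_const_mul, ← integral_add ((f.integrable_phase_mul σ _).mul_wave σ p)
          ((((F.component i).integrable_phase_mul σ _).mul_wave σ p).const_mul _)]
        refine integral_congr_ae (ae_of_all _ fun k => ?_)
        simp only [amp]
        ring
    obtain ⟨hA, hB⟩ := amplitudes_eq_zero hc (hcont (-c) f F) (hcont c g G) (hint _ _ _)
      (hint _ _ _) (fun p => by
        have hp := congrFun (h p) i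
        simp only [Pi.add_apply, Pi.smul_apply, gradC, pxd_pwScalar, ptd_pwVec_apply,
          smul_eq_mul, Pi.zero_apply] at hp
        rw [hsplit, hsplit, ← hp]
        ring) hk
    simp only [amp, phase_space, phase_time, SchwartzMap.component_apply] at hA hB
    push_cast at hA hB ⊢
    field_simp at hA hB ⊢
    have hI := Complex.I_ne_zero
    constructor <;> grind
  · have hn : (norm3 k : ℂ) ≠ 0 := by exact_mod_cast (norm3_pos hk).ne'
    let amp : ℝ → SchwartzMap V3 ℂ → SchwartzMap V3 (Fin 3 → ℂ) → V3 → ℂ := fun σ f F k =>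
      (Complex.I * (phase σ k (1, 0) : ℂ)) * f k +
        ∑ i, (Complex.I * (phase σ k (0, Pi.single i 1) : ℂ)) * F.component i k
    have hcont : ∀ σ f F, Continuous (amp σ f F) := fun σ f F => by
      have h1 := fun i => hphase σ (0, Pi.single i 1)
      have h2 := hphase σ (1, 0)
      fun_prop
    have hint : ∀ σ f F, Integrable (amp σ f F) := fun σ f F =>
      (f.integrable_phase_mul σ _).add
        (integrable_finsetSum _ fun i _ => (F.component i).integrable_phase_mul σ _)
    have hsplit : ∀ σ f F p, ∫ k, amp σ f F k * wave σ p k =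
        (∫ k, (Complex.I * (phase σ k (1, 0) : ℂ)) * f k * wave σ p k) +
        ∑ i, ∫ k, (Complex.I * (phase σ k (0, Pi.single i 1) : ℂ)) * F.component i k *
          wave σ p k := fun σ f F p => by
      have hi := fun i =>
        ((F.component i).integrable_phase_mul σ (0, Pi.single i 1)).mul_wave σ p
      rw [← integral_finsetSum _ fun i _ => hi i,
        ← integral_add ((f.integrable_phase_mul σ _).mul_wave σ p)
          (integrable_finsetSum _ fun i _ => hi i)]
      refine integral_congr_ae (ae_of_all _ fun k => ?_)
      simp only [amp, add_mul, Finset.sum_mul]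
    obtain ⟨hA, hB⟩ := amplitudes_eq_zero hc (hcont (-c) f F) (hcont c g G) (hint _ _ _)
      (hint _ _ _) (fun p => by
        have hp := h p
        simp only [divgC, pwVec_apply] at hp
        rw [ptd, (hasDerivAt_pwScalar c f g p).deriv] at hp
        simp only [pxd_pwScalar, Finset.sum_add_distrib] at hp
        rw [hsplit, hsplit, ← hp]
        ring) hk
    simp only [amp, phase_space, phase_time, SchwartzMap.component_apply, mul_assoc,
      ← Finset.mul_sum, ← mul_add] at hA hB
    replace hA := (mul_eq_zero.1 hA).resolve_left Complex.I_ne_zero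
    replace hB := (mul_eq_zero.1 hB).resolve_left Complex.I_ne_zero
    push_cast at hA hB ⊢
    constructor
    · field_simp
      linear_combination -hA
    · field_simp
      linear_combination hB
end
end

section
/- Define the spherical Bessel function j_l : (0, ∞) → ℝ by the Rayleigh formula j_l(s) = (−1)^l s^l ((1/s) d/ds)^l (sin s / s), where ((1/s) d/ds)^l denotes the l-fold iterate of the operator sending a differentiable function h to s ↦ h'(s)/s. Let r₀ > 0, k > 0 and l ∈ ℕ with j_l(k r₀) = 0. Then ∫₀^{r₀} j_l(k r)² r² dr = (r₀³/2) · (j_l'(k r₀))². -/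
noncomputable section

open Real MeasureTheory Filter

/-- The spherical Bessel function `j_l`, via the Rayleigh formula
`j_l(s) = (-1)^l s^l ((1/s) d/ds)^l (sin s / s)`. -/
def sphericalBessel (l : ℕ) : ℝ → ℝ :=
  fun s => (-1 : ℝ) ^ l * s ^ l *
    ((fun h : ℝ → ℝ => fun t => deriv h t / t)^[l] (fun t => Real.sin t / t)) s

/-- The numerator `s ^ (l + 1) * (-1) ^ l * j_l(s)`, extended to an entire function of `s`. -/
def besselNumerator : ℕ → ℝ → ℝ
  | 0, s => Real.sin s
  | 1, s => s * Real.cos s - Real.sin s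
  | l + 2, s => -(2 * (l : ℝ) + 3) * besselNumerator (l + 1) s - s ^ 2 * besselNumerator l s

theorem hasDerivAt_besselNumerator_succ (l : ℕ) (s : ℝ) :
    HasDerivAt (besselNumerator (l + 1)) (-s * besselNumerator l s) s := by
  induction l using Nat.strong_induction_on generalizing s with
  | _ l ih =>
    match l with
    | 0 =>
      have h := ((hasDerivAt_id' s).mul (Real.hasDerivAt_cos s)).sub (Real.hasDerivAt_sin s)
      exact h.congr_deriv (by simp [besselNumerator])
    | 1 =>
      have h := ((ih 0 (by simp) s).const_mul (-(2 * ((0 : ℕ) : ℝ) + 3))).sub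
        ((hasDerivAt_pow 2 s).mul (Real.hasDerivAt_sin s))
      exact h.congr_deriv (by simp [besselNumerator]; ring)
    | l + 2 =>
      have h := ((ih (l + 1) (by simp) s).const_mul (-(2 * ((l + 1 : ℕ) : ℝ) + 3))).sub
        ((hasDerivAt_pow 2 s).mul (ih l (by simp) s))
      exact h.congr_deriv (by simp [besselNumerator]; ring)

theorem hasDerivAt_besselNumerator (l : ℕ) {s : ℝ} (hs : s ≠ 0) :
    HasDerivAt (besselNumerator l)
      ((besselNumerator (l + 1) s + (2 * (l : ℝ) + 1) * besselNumerator l s) / s) s := by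
  cases l with
  | zero =>
    exact (Real.hasDerivAt_sin s).congr_deriv (by simp [besselNumerator]; field_simp)
  | succ l =>
    refine (hasDerivAt_besselNumerator_succ l s).congr_deriv ?_
    rw [eq_div_iff hs, besselNumerator]
    push_cast
    ring

theorem continuous_besselNumerator (l : ℕ) : Continuous (besselNumerator l) := by
  cases l with
  | zero => exact Real.continuous_sin
  | succ l =>
    exact continuous_iff_continuousAt.2 fun s =>
      (hasDerivAt_besselNumerator_succ l s).continuousAt

theorem besselNumerator_zero_right (l : ℕ) : besselNumerator l 0 = 0 := by
  induction l using Nat.twoStepInduction with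
  | zero => simp [besselNumerator]
  | one => simp [besselNumerator]
  | more l _ h => simp [besselNumerator, h]

theorem abs_besselNumerator_le (l : ℕ) {s : ℝ} (hs : 0 ≤ s) :
    |besselNumerator l s| ≤ s ^ (2 * l + 1) := by
  induction l generalizing s with
  | zero => simpa [besselNumerator, abs_of_nonneg hs] using Real.abs_sin_le_abs (x := s)
  | succ l ih =>
    have h := norm_image_sub_le_of_norm_deriv_le_segment'
      (f := besselNumerator (l + 1)) (C := s ^ (2 * l + 2)) (a := 0) (b := s)
      (fun x _ => (hasDerivAt_besselNumerator_succ l x).hasDerivWithinAt)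
      (fun x hx => by
        rw [norm_mul, norm_neg, Real.norm_eq_abs, Real.norm_eq_abs, abs_of_nonneg hx.1]
        calc x * |besselNumerator l x| ≤ s * s ^ (2 * l + 1) :=
              mul_le_mul hx.2.le ((ih hx.1).trans (pow_le_pow_left₀ hx.1 hx.2.le _))
                (abs_nonneg _) hs
          _ = s ^ (2 * l + 2) := by ring)
      s ⟨hs, le_rfl⟩
    rw [besselNumerator_zero_right, sub_zero, sub_zero, Real.norm_eq_abs] at h
    exact h.trans_eq (by ring)

theorem iterate_rayleigh_eq (l : ℕ) {s : ℝ} (hs : 0 < s) :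
    ((fun h : ℝ → ℝ => fun t => deriv h t / t)^[l] (fun t => Real.sin t / t)) s =
      besselNumerator l s / s ^ (2 * l + 1) := by
  induction l generalizing s with
  | zero => simp [besselNumerator]
  | succ l ih =>
    rw [Function.iterate_succ_apply']
    have heq := (eventually_gt_nhds hs).mono fun x hx => ih hx
    have hd := (hasDerivAt_besselNumerator l hs.ne').div (hasDerivAt_pow (2 * l + 1) s)
      (pow_ne_zero _ hs.ne')
    have hd' := (hd.congr_of_eventuallyEq heq).deriv
    rw [hd']
    simp only [Nat.add_sub_cancel]
    push_cast
    field_simp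
    ring

theorem sphericalBessel_eq_div (l : ℕ) {s : ℝ} (hs : 0 < s) :
    sphericalBessel l s = (-1) ^ l * (besselNumerator l s / s ^ (l + 1)) := by
  rw [sphericalBessel, iterate_rayleigh_eq l hs]
  field_simp
  ring

theorem deriv_sphericalBessel_of_eq_zero (l : ℕ) {s : ℝ} (hs : 0 < s)
    (h : besselNumerator l s = 0) :
    deriv (sphericalBessel l) s = (-1) ^ l * (besselNumerator (l + 1) s / s ^ (l + 2)) := by
  have heq := (eventually_gt_nhds hs).mono fun x hx => sphericalBessel_eq_div l hx
  have hd := ((hasDerivAt_besselNumerator l hs.ne').div (hasDerivAt_pow (l + 1) s)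
    (pow_ne_zero _ hs.ne')).const_mul ((-1 : ℝ) ^ l)
  have hd' := (hd.congr_of_eventuallyEq heq).deriv
  rw [hd', h]
  field_simp
  ring

/-- An antiderivative of `s ^ 2 * j_l(s) ^ 2` on `(0, ∞)`, vanishing at `0`. -/
def besselSqPrimitive (l : ℕ) (s : ℝ) : ℝ :=
  ((2 * (l : ℝ) + 1) * (besselNumerator l s * besselNumerator (l + 1) s) +
    besselNumerator (l + 1) s ^ 2 + s ^ 2 * besselNumerator l s ^ 2) / (2 * s ^ (2 * l + 1))

theorem besselSqPrimitive_zero_right (l : ℕ) : besselSqPrimitive l 0 = 0 := by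
  simp [besselSqPrimitive]

theorem hasDerivAt_besselSqPrimitive (l : ℕ) {s : ℝ} (hs : 0 < s) :
    HasDerivAt (besselSqPrimitive l) (sphericalBessel l s ^ 2 * s ^ 2) s := by
  have h0 := hasDerivAt_besselNumerator l hs.ne'
  have h1 := hasDerivAt_besselNumerator_succ l s
  have hd := ((((h0.mul h1).const_mul (2 * (l : ℝ) + 1)).add (h1.pow 2)).add
    ((hasDerivAt_pow 2 s).mul (h0.pow 2))).div ((hasDerivAt_pow (2 * l + 1) s).const_mul 2)
    (mul_ne_zero two_ne_zero (pow_ne_zero _ hs.ne'))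
  refine hd.congr_deriv ?_
  rw [sphericalBessel_eq_div l hs, mul_pow ((-1 : ℝ) ^ l), pow_right_comm, neg_one_sq,
    one_pow, one_mul]
  simp only [Nat.add_sub_cancel, Pi.mul_apply, Pi.add_apply, Pi.pow_apply]
  push_cast
  field_simp
  ring

theorem abs_besselSqPrimitive_le (l : ℕ) {s : ℝ} (hs : 0 ≤ s) :
    |besselSqPrimitive l s| ≤ s ^ (2 * l + 3) * (2 * l + 2 + s ^ 2) / 2 := by
  rcases hs.eq_or_lt with rfl | hs'
  · simp [besselSqPrimitive]
  have h0 := abs_besselNumerator_le l hs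
  have h1 := abs_besselNumerator_le (l + 1) hs
  rw [besselSqPrimitive, abs_div, abs_of_pos (by positivity : 0 < 2 * s ^ (2 * l + 1)),
    div_le_iff₀ (by positivity)]
  calc _ ≤ (2 * (l : ℝ) + 1) * (|besselNumerator l s| * |besselNumerator (l + 1) s|) +
        |besselNumerator (l + 1) s| ^ 2 + s ^ 2 * |besselNumerator l s| ^ 2 := by
        refine (abs_add_three _ _ _).trans_eq ?_
        simp only [abs_mul, abs_pow, abs_of_pos hs',
          abs_of_pos (by positivity : 0 < 2 * (l : ℝ) + 1)]
    _ ≤ (2 * (l : ℝ) + 1) * (s ^ (2 * l + 1) * s ^ (2 * (l + 1) + 1)) +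
        (s ^ (2 * (l + 1) + 1)) ^ 2 + s ^ 2 * (s ^ (2 * l + 1)) ^ 2 := by gcongr
    _ = _ := by ring

theorem continuousOn_besselSqPrimitive (l : ℕ) :
    ContinuousOn (besselSqPrimitive l) (Set.Ici 0) := by
  intro s hs
  rcases (Set.mem_Ici.1 hs).eq_or_lt with rfl | hs'
  · rw [ContinuousWithinAt, besselSqPrimitive_zero_right]
    refine squeeze_zero_norm' (eventually_mem_nhdsWithin.mono fun x hx =>
      abs_besselSqPrimitive_le l hx) ?_
    have hc : Continuous fun x : ℝ => x ^ (2 * l + 3) * (2 * l + 2 + x ^ 2) / 2 := by fun_prop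
    simpa using (hc.tendsto 0).mono_left nhdsWithin_le_nhds
  · exact (hasDerivAt_besselSqPrimitive l hs').continuousAt.continuousWithinAt

/-- normalization of the radial eigenfunction `r ↦ j_l(kr)` with
respect to the measure `r² dr` on `(0, r₀)`, when `j_l(k r₀) = 0`:
`∫₀^{r₀} j_l(kr)² r² dr = (r₀³/2) (j_l'(k r₀))²`. -/
theorem stmt_19 (r₀ k : ℝ) (l : ℕ) (hr₀ : 0 < r₀) (hk : 0 < k)
    (hzero : sphericalBessel l (k * r₀) = 0) :
    ∫ r in Set.Ioc (0:ℝ) r₀, (sphericalBessel l (k * r)) ^ 2 * r ^ 2 =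
      (r₀ ^ 3 / 2) * (deriv (sphericalBessel l) (k * r₀)) ^ 2 := by
  have ha : 0 < k * r₀ := mul_pos hk hr₀
  have hcont : ContinuousOn (fun r => besselSqPrimitive l (k * r) / k ^ 3) (Set.Icc 0 r₀) :=
    ((continuousOn_besselSqPrimitive l).comp (by fun_prop)
      fun r hr => mul_nonneg hk.le hr.1).div_const _
  have hderiv : ∀ r ∈ Set.Ioo 0 r₀, HasDerivAt (fun r => besselSqPrimitive l (k * r) / k ^ 3)
      (sphericalBessel l (k * r) ^ 2 * r ^ 2) r := fun r hr => by
    have h := (hasDerivAt_besselSqPrimitive l (mul_pos hk hr.1)).comp r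
      ((hasDerivAt_id' r).const_mul k)
    refine (h.div_const (k ^ 3)).congr_deriv ?_
    field_simp
  have hint := intervalIntegral.integrableOn_deriv_of_nonneg hcont hderiv
    fun r _ => by positivity
  rw [← intervalIntegral.integral_of_le hr₀.le,
    intervalIntegral.integral_eq_sub_of_hasDerivAt_of_le hr₀.le hcont hderiv
      ((intervalIntegrable_iff_integrableOn_Ioc_of_le hr₀.le).2 hint)]
  have hT : besselNumerator l (k * r₀) = 0 := by
    simpa [sphericalBessel_eq_div l ha, hk.ne', hr₀.ne'] using hzero
  rw [deriv_sphericalBessel_of_eq_zero l ha hT, mul_zero, besselSqPrimitive_zero_right,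
    besselSqPrimitive, hT, mul_pow ((-1 : ℝ) ^ l), pow_right_comm, neg_one_sq,
    one_pow, one_mul]
  field_simp
  ring
end
end
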